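/- arXiv:1006.1363 — 3 statements merged into one kernel-verified Lean document; each statement's English description precedes it below -/
import Mathlib

section
/- Let G be a finite group. The map sending a supercharacter theory (𝒳,𝒦) of G to the ℂ-linear span of {K̂ : K ∈ 𝒦} in ℂ[G] is a bijection from the set of supercharacter theories of G onto the set of Schur rings of G contained in the center Z(ℂ[G]). -/
open scoped Classical

noncomputable section

/-- The set of irreducible complex characters of `G`. -/
def Irr (G : Type) [Group G] : Set (G → ℂ) :=
  {χ | ∃ V : FDRep ℂ G, CategoryTheory.Simple V ∧ FDRep.character V = χ}

/-- `σ_X = ∑_{ψ ∈ X} ψ(1)·ψ`. -/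
def sigmaChar {G : Type} [Group G] (X : Set (G → ℂ)) : G → ℂ :=
  fun g => ∑ᶠ ψ ∈ X, ψ 1 * ψ g

/-- `P` is a set partition of the set `S`. -/
def IsPartitionOf {α : Type*} (S : Set α) (P : Set (Set α)) : Prop :=
  ∅ ∉ P ∧ (∀ p ∈ P, p ⊆ S) ∧ ∀ a ∈ S, ∃! p, p ∈ P ∧ a ∈ p

/-- `(𝒳, 𝒦)` is a supercharacter theory of the finite group `G`. -/
def IsSCT (G : Type) [Group G] [Finite G]
    (𝒳 : Set (Set (G → ℂ))) (𝒦 : Set (Set G)) : Prop :=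
  IsPartitionOf (Irr G) 𝒳 ∧ IsPartitionOf Set.univ 𝒦 ∧ 𝒳.ncard = 𝒦.ncard ∧
    ({1} : Set G) ∈ 𝒦 ∧
    ∀ X ∈ 𝒳, ∀ K ∈ 𝒦, ∀ g ∈ K, ∀ h ∈ K, sigmaChar X g = sigmaChar X h

/-- `K̂ = ∑_{g ∈ K} g ∈ ℂ[G]`. -/
def ghat {G : Type} [Group G] (K : Set G) : MonoidAlgebra ℂ G :=
  ∑ᶠ g ∈ K, MonoidAlgebra.single g (1 : ℂ)

/-- The central idempotent `e_χ = (χ(1)/|G|) ∑_g conj(χ g)·g` attached to a character. -/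
def eIdem (G : Type) [Group G] (χ : G → ℂ) : MonoidAlgebra ℂ G :=
  (χ 1 / (Nat.card G : ℂ)) •
    ∑ᶠ g : G, (starRingEnd ℂ) (χ g) • MonoidAlgebra.single g (1 : ℂ)

/-- `f_X = ∑_{ψ ∈ X} e_ψ`. -/
def fIdem (G : Type) [Group G] (X : Set (G → ℂ)) : MonoidAlgebra ℂ G :=
  ∑ᶠ χ ∈ X, eIdem G χ

/-- Partition order: every part of `P` lies in some part of `Q`. -/
def PartLE {α : Type*} (P Q : Set (Set α)) : Prop := ∀ p ∈ P, ∃ q ∈ Q, p ⊆ q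

/-- The join of two partitions of the same set: parts are connected components of
the relation "lying in a common part of `P` or of `Q`". -/
def PartJoin {α : Type*} (P Q : Set (Set α)) : Set (Set α) :=
  {C | ∃ a ∈ ⋃₀ P, C = {b | Relation.ReflTransGen
      (fun x y => (∃ p ∈ P, x ∈ p ∧ y ∈ p) ∨ ∃ q ∈ Q, x ∈ q ∧ y ∈ q) a b}}

/-- Inner product of complex-valued functions on a finite group. -/
def cInner (H : Type) [Group H] (α β : H → ℂ) : ℂ :=
  (Nat.card H : ℂ)⁻¹ * ∑ᶠ h : H, α h * (starRingEnd ℂ) (β h)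

/-- Restriction of a function on `G` to a subgroup. -/
def resChar {G : Type} [Group G] (H : Subgroup G) (χ : G → ℂ) : ↥H → ℂ := fun h => χ ↑h

/-- Extension by zero of a function on a subgroup. -/
def zeroExtend {G : Type} [Group G] (H : Subgroup G) (φ : ↥H → ℂ) : G → ℂ :=
  fun g => if h : g ∈ H then φ ⟨g, h⟩ else 0

/-- The induced class function `φ^G`. -/
def indChar {G : Type} [Group G] (H : Subgroup G) (φ : ↥H → ℂ) : G → ℂ :=
  fun g => (Nat.card ↥H : ℂ)⁻¹ * ∑ᶠ x : G, zeroExtend H φ (x⁻¹ * g * x)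

/-- The superclass of `x` with respect to a partition `𝒦` of `G`. -/
def sclass {G : Type} [Group G] (𝒦 : Set (Set G)) (x : G) : Set G := ⋃₀ {K ∈ 𝒦 | x ∈ K}

/-- Superinduction: `φ^{(G)}(x) = [G:H]·(1/|[x]|)·∑_{y ∈ [x]} φ⁰(y)`. -/
def superInd {G : Type} [Group G] (𝒦 : Set (Set G)) (H : Subgroup G) (φ : ↥H → ℂ) : G → ℂ :=
  fun x => (H.index : ℂ) * (((sclass 𝒦 x).ncard : ℂ))⁻¹ * ∑ᶠ y ∈ sclass 𝒦 x, zeroExtend H φ y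

/-- A subgroup is `𝒞`-normal when it is a union of superclasses. -/
def CNormal {G : Type} [Group G] (𝒦 : Set (Set G)) (N : Subgroup G) : Prop :=
  ∃ T ⊆ 𝒦, (N : Set G) = ⋃₀ T

/-- `Irr(G/N)` viewed inside `Irr(G)`: irreducible characters with `N` in their kernel. -/
def IrrOver {G : Type} [Group G] (N : Subgroup G) : Set (G → ℂ) :=
  {χ ∈ Irr G | ∀ n ∈ N, χ n = χ 1}

/-- The set of irreducible constituents of the restriction of `θ` to `N`. -/
def constituentsOn {G : Type} [Group G] (N : Subgroup G) (θ : G → ℂ) : Set (↥N → ℂ) :=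
  {ψ ∈ Irr ↥N | cInner ↥N (resChar N θ) ψ ≠ 0}

/-- `Irr(G|ψ)`: irreducible characters of `G` lying over `ψ ∈ Irr(N)`. -/
def irrOverChar {G : Type} [Group G] (N : Subgroup G) (ψ : ↥N → ℂ) : Set (G → ℂ) :=
  {χ ∈ Irr G | cInner ↥N (resChar N χ) ψ ≠ 0}

/-- `X^G = ⋃_{ψ ∈ X} Irr(G|ψ)` for `X ⊆ Irr(N)`. -/
def indSet {G : Type} [Group G] (N : Subgroup G) (X : Set (↥N → ℂ)) : Set (G → ℂ) :=
  ⋃ ψ ∈ X, irrOverChar N ψ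

/-- Conjugation of a normal subgroup by a group element. -/
def conjSub {G : Type} [Group G] {N : Subgroup G} (hN : N.Normal) (g : G) (n : ↥N) : ↥N :=
  ⟨g * ↑n * g⁻¹, hN.conj_mem ↑n n.2 g⟩

/-- The conjugation action of `g ∈ G` on class functions of a normal subgroup `N`. -/
def charConj {G : Type} [Group G] {N : Subgroup G} (hN : N.Normal) (g : G)
    (ψ : ↥N → ℂ) : ↥N → ℂ :=
  fun n => ψ (conjSub hN g⁻¹ n)

/-- Inflation of a set of characters of `G/N` to characters of `G`. -/
def inflateSet {G : Type} [Group G] (N : Subgroup G) [N.Normal]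
    (Y : Set (G ⧸ N → ℂ)) : Set (G → ℂ) :=
  (fun η => η ∘ (QuotientGroup.mk : G → G ⧸ N)) '' Y

/-- Deflation of a set of characters of `G` (with `N` in their kernels) to characters
of `G/N`. -/
def deflate {G : Type} [Group G] (N : Subgroup G) [N.Normal]
    (X : Set (G → ℂ)) : Set (G ⧸ N → ℂ) :=
  (fun χ => fun q : G ⧸ N => χ (Quotient.out q)) '' X

/-- The natural map `M → MN/N ≤ G/N`. -/
def projMN {G : Type} [Group G] (M N : Subgroup G) [N.Normal] (m : ↥M) :
    ↥(M.map (QuotientGroup.mk' N)) :=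
  ⟨QuotientGroup.mk' N ↑m, Subgroup.mem_map_of_mem _ m.2⟩

end

/-- `A ⊆ ℂ[G]` is a Schur ring over `G`: it is (the carrier of) a subring, and there is
a partition `𝒦` of `G` such that `{K̂ : K ∈ 𝒦}` is a `ℂ`-linear basis of `A`,
`{1} ∈ 𝒦`, and `𝒦` is closed under pointwise inversion of parts. -/
def IsSchurRing {G : Type} [Group G] [Finite G] (A : Set (MonoidAlgebra ℂ G)) : Prop :=
  (∃ S : Subring (MonoidAlgebra ℂ G), (S : Set (MonoidAlgebra ℂ G)) = A) ∧
  ∃ 𝒦 : Set (Set G), IsPartitionOf Set.univ 𝒦 ∧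
    LinearIndependent ℂ (fun K : 𝒦 => ghat (K : Set G)) ∧
    A = ↑(Submodule.span ℂ ((fun K => ghat K) '' 𝒦)) ∧
    ({1} : Set G) ∈ 𝒦 ∧
    ∀ K ∈ 𝒦, (fun g => g⁻¹) '' K ∈ 𝒦

section CharacterTheory

/-- The linear extension of a function on `G` to the group algebra. -/
noncomputable def evalFun {G : Type} [Fintype G] (χ : G → ℂ) : MonoidAlgebra ℂ G →ₗ[ℂ] ℂ where
  toFun z := ∑ g, z.coeff g * χ g
  map_add' x y := by simp [add_mul, Finset.sum_add_distrib]
  map_smul' c x := by simp [mul_assoc, Finset.mul_sum]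

lemma evalFun_apply {G : Type} [Fintype G] (χ : G → ℂ) (z : MonoidAlgebra ℂ G) :
    evalFun χ z = ∑ g, z.coeff g * χ g := rfl

lemma sum_single_coeff {G : Type} [Fintype G] (z : MonoidAlgebra ℂ G) :
    z = ∑ g, MonoidAlgebra.single g (z.coeff g) := by
  ext h
  simp [MonoidAlgebra.coeff_sum]

variable {G : Type} [Group G]

lemma mem_center_iff_coeff [Fintype G] (z : MonoidAlgebra ℂ G) :
    z ∈ Subalgebra.center ℂ (MonoidAlgebra ℂ G) ↔
      ∀ g h, z.coeff (h * g * h⁻¹) = z.coeff g := by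
  rw [Subalgebra.mem_center_iff]
  constructor
  · intro hz g h
    have := congrArg (fun x => x.coeff (h * g)) (hz (MonoidAlgebra.single h 1))
    simpa using this.symm
  · intro hz b
    have key : ∀ h, MonoidAlgebra.single h 1 * z = z * MonoidAlgebra.single h (1 : ℂ) := by
      intro h
      ext g
      simp [← hz (h⁻¹ * g) h]
    induction b using MonoidAlgebra.induction_on with
    | of g => simpa using key g
    | add f g hf hg => simp [add_mul, mul_add, hf, hg]
    | smul r f hf => simp [hf]

lemma trace_asAlgebraHom [Fintype G] (V : FDRep ℂ G) (z : MonoidAlgebra ℂ G) :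
    LinearMap.trace ℂ V (Representation.asAlgebraHom V.ρ z) = evalFun V.character z := by
  conv_lhs => rw [sum_single_coeff z]
  simp [evalFun_apply, FDRep.character]

/-- Schur's lemma: central elements of the group algebra act by scalars. -/
lemma exists_asAlgebraHom_eq_smul_one [Fintype G] (V : FDRep ℂ G) [CategoryTheory.Simple V]
    {z : MonoidAlgebra ℂ G} (hz : z ∈ Subalgebra.center ℂ (MonoidAlgebra ℂ G)) :
    ∃ c : ℂ, Representation.asAlgebraHom V.ρ z = c • 1 := by
  have hrank : Module.finrank ℂ (Representation.linHom V.ρ V.ρ).invariants = 1 := by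
    rw [(Representation.linHom.invariantsEquivFDRepHom V V).finrank_eq]
    exact CategoryTheory.finrank_endomorphism_simple_eq_one ℂ V
  have hmem : ∀ w ∈ Subalgebra.center ℂ (MonoidAlgebra ℂ G),
      Representation.asAlgebraHom V.ρ w ∈ (Representation.linHom V.ρ V.ρ).invariants := by
    intro w hw g
    have hcomm := congrArg (Representation.asAlgebraHom V.ρ)
      (Subalgebra.mem_center_iff.1 hw (MonoidAlgebra.single g 1))
    simp only [map_mul, Representation.asAlgebraHom_single_one] at hcomm
    rw [Representation.linHom_apply]
    change V.ρ g * (Representation.asAlgebraHom V.ρ w * V.ρ g⁻¹) = _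
    rw [← mul_assoc, hcomm, mul_assoc, ← map_mul]
    simp
  have hone : (1 : Module.End ℂ V) ∈ (Representation.linHom V.ρ V.ρ).invariants := by
    simpa using hmem 1 (one_mem _)
  have hne : (⟨1, hone⟩ : (Representation.linHom V.ρ V.ρ).invariants) ≠ 0 := by
    intro h0
    have h1 : (1 : Module.End ℂ V) = 0 := congrArg Subtype.val h0
    obtain ⟨w, hw⟩ := (Module.finrank_pos_iff_exists_ne_zero (R := ℂ)).mp
      (hrank.symm ▸ Nat.one_pos)
    apply hw
    ext1
    have : w.1 = 1 * w.1 := (one_mul (M := Module.End ℂ V) w.1).symm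
    rw [this, h1, zero_mul]
    rfl
  obtain ⟨c, hc⟩ := (finrank_eq_one_iff_of_nonzero' _ hne).mp hrank ⟨_, hmem z hz⟩
  exact ⟨c, (congrArg Subtype.val hc).symm⟩

lemma sum_mul_inv_of_mem_Irr [Fintype G] {χ ψ : G → ℂ} (hχ : χ ∈ Irr G) (hψ : ψ ∈ Irr G) :
    ∑ g, χ g * ψ g⁻¹ = if χ = ψ then (Nat.card G : ℂ) else 0 := by
  obtain ⟨V, hV, rfl⟩ := hχ
  obtain ⟨W, hW, rfl⟩ := hψ
  split_ifs with h
  · rw [← h]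
    exact (FDRep.simple_iff_char_is_norm_one V).1 hV
  · have hcard : (Nat.card G : ℂ) ≠ 0 := by simp
    have := invertibleOfNonzero hcard
    have horth := FDRep.char_orthonormal V W
    rw [if_neg fun ⟨i⟩ => h (FDRep.char_iso i)] at horth
    simpa [hcard] using horth

lemma apply_one_ne_zero_of_mem_Irr [Fintype G] {χ : G → ℂ} (hχ : χ ∈ Irr G) : χ 1 ≠ 0 := by
  intro h0
  have horth := sum_mul_inv_of_mem_Irr hχ hχ
  obtain ⟨V, hV, rfl⟩ := hχ
  rw [FDRep.char_one, Nat.cast_eq_zero] at h0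
  have hV0 : Subsingleton V := Module.finrank_zero_iff.1 h0
  have hz : ∀ g, V.character g = 0 := by
    intro g
    have : V.ρ g = 0 := Subsingleton.elim _ _
    simp [FDRep.character, this]
  simp [hz, eq_comm] at horth

lemma conj_mem_Irr {χ : G → ℂ} (hχ : χ ∈ Irr G) (g h : G) : χ (h * g * h⁻¹) = χ g := by
  obtain ⟨V, -, rfl⟩ := hχ
  exact FDRep.char_conj V g h

/-- Central characters are multiplicative. -/
lemma evalFun_mul [Fintype G] {χ : G → ℂ} (hχ : χ ∈ Irr G) {z w : MonoidAlgebra ℂ G}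
    (hz : z ∈ Subalgebra.center ℂ (MonoidAlgebra ℂ G))
    (hw : w ∈ Subalgebra.center ℂ (MonoidAlgebra ℂ G)) :
    evalFun χ (z * w) * χ 1 = evalFun χ z * evalFun χ w := by
  obtain ⟨V, hV, rfl⟩ := hχ
  obtain ⟨c, hc⟩ := exists_asAlgebraHom_eq_smul_one V hz
  obtain ⟨d, hd⟩ := exists_asAlgebraHom_eq_smul_one V hw
  simp only [← trace_asAlgebraHom, map_mul, hc, hd, FDRep.char_one]
  simp
  ring

/-- A central element on which all irreducible characters vanish annihilates simple modules. -/
lemma smul_eq_zero_of_evalFun_eq_zero [Fintype G] {z : MonoidAlgebra ℂ G}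
    (hz : z ∈ Subalgebra.center ℂ (MonoidAlgebra ℂ G))
    (h : ∀ χ ∈ Irr G, evalFun χ z = 0) (M : Type) [AddCommGroup M] [Module ℂ M]
    [Module (MonoidAlgebra ℂ G) M] [IsScalarTower ℂ (MonoidAlgebra ℂ G) M]
    [IsSimpleModule (MonoidAlgebra ℂ G) M] (x : M) :
    z • x = 0 := by
  have hcard : (Nat.card G : ℂ) ≠ 0 := by simp
  have := invertibleOfNonzero hcard
  have : Module.Finite ℂ M := Module.Finite.trans (MonoidAlgebra ℂ G) M
  let ρ : Representation ℂ G M := Representation.ofModule' M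
  have hρ : ∀ w y, ρ.asAlgebraHom w y = w • y := by
    intro w y
    rw [Representation.asAlgebraHom_def]
    simp only [ρ, Representation.ofModule', Equiv.apply_symm_apply]
    rfl
  let e : ρ.asModule ≃ₗ[MonoidAlgebra ℂ G] M :=
    { ρ.asModuleEquiv.toAddEquiv with map_smul' := fun w y => hρ w (ρ.asModuleEquiv y) }
  have hirr : ρ.IsIrreducible :=
    (Representation.irreducible_iff_isSimpleModule_asModule ρ).2 (IsSimpleModule.congr e)
  let V : FDRep ℂ G := FDRep.of ρ
  have hV : CategoryTheory.Simple V := by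
    rw [FDRep.simple_iff_char_is_norm_one]
    have horth := Representation.char_orthonormal ρ ρ
    rw [if_pos ⟨Representation.Equiv.refl _⟩, inv_mul_eq_one₀ hcard] at horth
    exact horth.symm
  obtain ⟨c, hc⟩ := exists_asAlgebraHom_eq_smul_one V hz
  have hχ : V.character ∈ Irr G := ⟨V, hV, rfl⟩
  have htr := trace_asAlgebraHom V z
  rw [h _ hχ, hc, map_smul, LinearMap.trace_one, ← FDRep.char_one] at htr
  have hc0 : c = 0 := by
    simpa [apply_one_ne_zero_of_mem_Irr hχ, -FDRep.char_one] using htr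
  rw [hc0, zero_smul] at hc
  have hc' : ρ.asAlgebraHom z = 0 := hc
  rw [← hρ, hc', LinearMap.zero_apply]

/-- A central element on which all irreducible characters vanish is zero. -/
lemma eq_zero_of_evalFun_eq_zero [Fintype G] {z : MonoidAlgebra ℂ G}
    (hz : z ∈ Subalgebra.center ℂ (MonoidAlgebra ℂ G))
    (h : ∀ χ ∈ Irr G, evalFun χ z = 0) : z = 0 := by
  have : NeZero (Nat.card G : ℂ) := ⟨by simp⟩
  have hjac : z ∈ Ring.jacobson (MonoidAlgebra ℂ G) := by
    rw [Ring.jacobson_eq_sInf_isMaximal, Submodule.mem_sInf]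
    intro m (hm : Ideal.IsMaximal m)
    have : IsSimpleModule (MonoidAlgebra ℂ G) (MonoidAlgebra ℂ G ⧸ m) :=
      isSimpleModule_iff_isCoatom.2 (Ideal.isMaximal_def.1 hm)
    have happ := smul_eq_zero_of_evalFun_eq_zero hz h (MonoidAlgebra ℂ G ⧸ m)
      (Submodule.Quotient.mk 1)
    rw [← Submodule.Quotient.mk_smul, Submodule.Quotient.mk_eq_zero] at happ
    simpa using happ
  rwa [IsSemisimpleRing.jacobson_eq_bot] at hjac

/-- Central elements are determined by the values of the irreducible characters. -/
lemma eq_of_evalFun_eq [Fintype G] {z w : MonoidAlgebra ℂ G}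
    (hz : z ∈ Subalgebra.center ℂ (MonoidAlgebra ℂ G))
    (hw : w ∈ Subalgebra.center ℂ (MonoidAlgebra ℂ G))
    (h : ∀ χ ∈ Irr G, evalFun χ z = evalFun χ w) : z = w :=
  sub_eq_zero.1 <| eq_zero_of_evalFun_eq_zero (sub_mem hz hw) fun χ hχ => by
    rw [map_sub, h χ hχ, sub_self]

open scoped ComplexOrder in
/-- The character of a complex representation of a finite group at the inverse is the complex
conjugate: the representation is unitary for an averaged inner product. -/
lemma FDRep.character_inv_eq_conj [Fintype G] (V : FDRep ℂ G) (g : G) :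
    V.character g⁻¹ = (starRingEnd ℂ) (V.character g) := by
  let b := Module.finBasis ℂ V
  let A : G →* Matrix _ _ ℂ :=
    (LinearMap.toMatrixAlgEquiv b).toRingEquiv.toMonoidHom.comp V.ρ
  have htr : ∀ g, V.character g = (A g).trace := fun g =>
    LinearMap.trace_eq_matrix_trace ℂ b (V.ρ g)
  let M := ∑ h, (A h).conjTranspose * A h
  have hM : M.PosDef := by
    have : M = 1 + ∑ h ∈ Finset.univ.erase 1, (A h).conjTranspose * A h := by
      simp only [M]
      rw [← Finset.add_sum_erase _ _ (Finset.mem_univ (1 : G))]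
      simp
    rw [this]
    exact Matrix.PosDef.one.add_posSemidef
      (Matrix.posSemidef_sum _ fun h _ => Matrix.posSemidef_conjTranspose_mul_self _)
  have hinv : (A g).conjTranspose * M * A g = M := by
    simp only [M, Finset.mul_sum, Finset.sum_mul]
    refine Fintype.sum_equiv (Equiv.mulRight g) _ _ fun h => ?_
    simp [Matrix.conjTranspose_mul, mul_assoc]
  have hdet : IsUnit M.det := (Matrix.isUnit_iff_isUnit_det M).1 hM.isUnit
  have hA : A g * A g⁻¹ = 1 := by rw [← map_mul]; simp
  have hMA : M * A g⁻¹ = (A g).conjTranspose * M := by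
    conv_lhs => rw [← hinv]
    rw [mul_assoc, hA, mul_one]
  rw [htr, htr]
  have : A g⁻¹ = M⁻¹ * ((A g).conjTranspose * M) := by
    rw [← hMA, ← mul_assoc, Matrix.nonsing_inv_mul _ hdet, one_mul]
  rw [this, Matrix.trace_mul_comm, mul_assoc, Matrix.mul_nonsing_inv _ hdet, mul_one,
    Matrix.trace_conjTranspose]
  rfl

lemma inv_eq_conj_of_mem_Irr [Fintype G] {χ : G → ℂ} (hχ : χ ∈ Irr G) (g : G) :
    χ g⁻¹ = (starRingEnd ℂ) (χ g) := by
  obtain ⟨V, -, rfl⟩ := hχ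
  exact V.character_inv_eq_conj g

end CharacterTheory

section Partitions

variable {α β : Type*}

/-- The algebra of complex functions that are constant on the classes of a setoid. -/
def constOn (r : Setoid α) : Subalgebra ℂ (α → ℂ) where
  carrier := {f | ∀ a b, r a b → f a = f b}
  mul_mem' hf hg a b h := by simp [hf a b h, hg a b h]
  add_mem' hf hg a b h := by simp [hf a b h, hg a b h]
  algebraMap_mem' c a b _ := rfl

lemma indicator_mem_constOn (r : Setoid α) (a : α) :
    Set.indicator {b | r a b} (1 : α → ℂ) ∈ constOn r := by
  intro b c hbc
  have hiff : r a b ↔ r a c := ⟨fun h => r.trans h hbc, fun h => r.trans h (r.symm hbc)⟩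
  simp [Set.indicator_apply, hiff]

lemma rel_iff_forall_mem_constOn (r : Setoid α) (a b : α) :
    r a b ↔ ∀ f ∈ constOn r, f a = f b := by
  refine ⟨fun h f hf => hf a b h, fun h => ?_⟩
  by_contra hab
  simpa [Set.indicator_apply, hab, r.refl a] using h _ (indicator_mem_constOn r a)

lemma constOn_injective : Function.Injective (constOn (α := α)) := by
  intro r s h
  ext a b
  rw [rel_iff_forall_mem_constOn, rel_iff_forall_mem_constOn, h]

/-- Functions constant on the classes of `r` are functions on the quotient. -/
noncomputable def constOnEquiv (r : Setoid α) :
    constOn r ≃ₗ[ℂ] (Quotient r → ℂ) where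
  toFun f := Quotient.lift f.1 f.2
  map_add' f g := by ext q; induction q using Quotient.inductionOn; rfl
  map_smul' c f := by ext q; induction q using Quotient.inductionOn; rfl
  invFun f := ⟨fun a => f ⟦a⟧, fun a b h => congrArg f (Quotient.sound h)⟩
  left_inv f := rfl
  right_inv f := by ext q; induction q using Quotient.inductionOn; rfl

lemma finrank_constOn [Finite α] (r : Setoid α) :
    Module.finrank ℂ (constOn r) = Nat.card (Quotient r) := by
  have := Fintype.ofFinite (Quotient r)
  rw [(constOnEquiv r).finrank_eq, Module.finrank_fintype_fun_eq_card, Nat.card_eq_fintype_card]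

/-- Functions constant on classes are combinations of the indicators of classes. -/
lemma mem_of_indicator_mem [Finite α] {r : Setoid α} {N : Submodule ℂ (α → ℂ)}
    (hN : ∀ a, Set.indicator {b | r a b} (1 : α → ℂ) ∈ N) {f : α → ℂ} (hf : f ∈ constOn r) :
    f ∈ N := by
  have := Fintype.ofFinite (Quotient r)
  have hsum : f = ∑ q : Quotient r, f q.out • Set.indicator {b | r q.out b} (1 : α → ℂ) := by
    ext a
    rw [Finset.sum_apply, Finset.sum_eq_single (⟦a⟧ : Quotient r)]
    · have : r (⟦a⟧ : Quotient r).out a := Quotient.mk_out a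
      simp [this, hf _ _ this]
    · intro q _ hq
      have : ¬ r q.out a := fun h => hq (by rw [← Quotient.sound h, Quotient.out_eq])
      simp [this]
    · simp
  rw [hsum]
  exact N.sum_mem fun q _ => N.smul_mem _ (hN _)

/-- Every algebra of functions on a finite set consists of the functions constant on the classes
of some setoid. -/
lemma exists_constOn_eq [Finite α] (S : Subalgebra ℂ (α → ℂ)) : ∃ r, constOn r = S := by
  have := Fintype.ofFinite α
  let r : Setoid α :=
    { r := fun a b => ∀ f ∈ S, f a = f b
      iseqv := ⟨fun _ _ _ => rfl, fun h f hf => (h f hf).symm,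
        fun h h' f hf => (h f hf).trans (h' f hf)⟩ }
  refine ⟨r, le_antisymm (fun f hf => ?_) fun f hf a b h => h f hf⟩
  refine mem_of_indicator_mem (N := Subalgebra.toSubmodule S) (fun a => ?_) hf
  have hsep : ∀ b, ∃ g ∈ S, g a = 1 ∧ (¬ r a b → g b = 0) := by
    intro b
    by_cases hab : r a b
    · exact ⟨1, one_mem S, rfl, fun h => absurd hab h⟩
    · obtain ⟨f, hf, hne⟩ : ∃ f ∈ S, f a ≠ f b := by
        by_contra! hcon
        exact hab hcon
      refine ⟨(f a - f b)⁻¹ • (f - algebraMap ℂ _ (f b)),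
        S.smul_mem (S.sub_mem hf (S.algebraMap_mem _)) _, ?_, fun _ => ?_⟩
      · simp [inv_mul_cancel₀ (sub_ne_zero.2 hne)]
      · simp
  choose g hgS hga hgb using hsep
  have hprod : Set.indicator {b | r a b} (1 : α → ℂ) = ∏ b, g b := by
    ext c
    rw [Finset.prod_apply]
    by_cases hac : r a c
    · have : ∀ b, g b c = 1 := fun b => by rw [← hac _ (hgS b), hga]
      simp [hac, this]
    · rw [Finset.prod_eq_zero (f := fun b => g b c) (Finset.mem_univ c) (hgb c hac)]
      simp [hac]
  rw [hprod]
  exact S.prod_mem fun b _ => hgS b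

lemma IsPartitionOf.eq_of_mem {S : Set β} {P : Set (Set β)} (hP : IsPartitionOf S P)
    {p q : Set β} (hp : p ∈ P) (hq : q ∈ P) {x : β} (hxp : x ∈ p) (hxq : x ∈ q) : p = q :=
  (hP.2.2 x (hP.2.1 p hp hxp)).unique ⟨hp, hxp⟩ ⟨hq, hxq⟩

lemma IsPartitionOf.nonempty {S : Set β} {P : Set (Set β)} (hP : IsPartitionOf S P)
    {p : Set β} (hp : p ∈ P) : p.Nonempty :=
  Set.nonempty_iff_ne_empty.2 fun h => hP.1 (h ▸ hp)

/-- The equivalence relation of a partition of `S`, pulled back along a map onto `S`. -/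
def partSetoid (e : α → β) {S : Set β} (he : Set.range e = S) {P : Set (Set β)}
    (hP : IsPartitionOf S P) : Setoid α where
  r a b := ∃ p ∈ P, e a ∈ p ∧ e b ∈ p
  iseqv := by
    refine ⟨fun a => ?_, fun ⟨p, hp, ha, hb⟩ => ⟨p, hp, hb, ha⟩, ?_⟩
    · obtain ⟨p, ⟨hp, ha⟩, -⟩ := hP.2.2 (e a) (he ▸ Set.mem_range_self a)
      exact ⟨p, hp, ha, ha⟩
    · rintro a b c ⟨p, hp, ha, hb⟩ ⟨q, hq, hb', hc⟩
      obtain rfl := hP.eq_of_mem hp hq hb hb'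
      exact ⟨p, hp, ha, hc⟩

variable {e : α → β} {S : Set β} {he : Set.range e = S} {P Q : Set (Set β)}

lemma partSetoid_iff_of_mem (hP : IsPartitionOf S P) {p : Set β} (hp : p ∈ P) {a : α}
    (ha : e a ∈ p) (b : α) : partSetoid e he hP a b ↔ e b ∈ p := by
  refine ⟨fun ⟨q, hq, ha', hb⟩ => ?_, fun hb => ⟨p, hp, ha, hb⟩⟩
  rwa [hP.eq_of_mem hp hq ha ha']

lemma IsPartitionOf.exists_eq_setOf (hP : IsPartitionOf S P) (he : Set.range e = S) (a : α) :
    ∃ p ∈ P, {b | partSetoid e he hP a b} = e ⁻¹' p := by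
  obtain ⟨p, hp, ha, -⟩ := (partSetoid e he hP).refl a
  exact ⟨p, hp, Set.ext fun b => partSetoid_iff_of_mem (he := he) hP hp ha b⟩

lemma IsPartitionOf.exists_apply_mem (hP : IsPartitionOf S P) (he : Set.range e = S)
    {p : Set β} (hp : p ∈ P) : ∃ a, e a ∈ p := by
  obtain ⟨x, hx⟩ := hP.nonempty hp
  obtain ⟨a, rfl⟩ := he.symm ▸ hP.2.1 p hp hx
  exact ⟨a, hx⟩

lemma subset_of_partSetoid_eq (hP : IsPartitionOf S P) (hQ : IsPartitionOf S Q)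
    (h : partSetoid e he hP = partSetoid e he hQ) : P ⊆ Q := by
  intro p hp
  obtain ⟨a, ha⟩ := hP.exists_apply_mem he hp
  obtain ⟨q, hq, haq, -⟩ := (partSetoid e he hQ).refl a
  suffices p = q from this ▸ hq
  ext x
  constructor <;> intro hx
  · obtain ⟨b, rfl⟩ := he.symm ▸ hP.2.1 p hp hx
    rwa [← partSetoid_iff_of_mem (he := he) hQ hq haq, ← h, partSetoid_iff_of_mem hP hp ha]
  · obtain ⟨b, rfl⟩ := he.symm ▸ hQ.2.1 q hq hx
    rwa [← partSetoid_iff_of_mem (he := he) hP hp ha, h, partSetoid_iff_of_mem hQ hq haq]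

lemma eq_of_partSetoid_eq (hP : IsPartitionOf S P) (hQ : IsPartitionOf S Q)
    (h : partSetoid e he hP = partSetoid e he hQ) : P = Q :=
  (subset_of_partSetoid_eq hP hQ h).antisymm (subset_of_partSetoid_eq hQ hP h.symm)

lemma card_quotient_partSetoid (hP : IsPartitionOf S P) :
    Nat.card (Quotient (partSetoid e he hP)) = P.ncard := by
  choose f hfP hf using fun a => (partSetoid e he hP).refl a
  have hsurj : Function.Surjective fun a => (⟨f a, hfP a⟩ : P) := by
    rintro ⟨p, hp⟩
    obtain ⟨a, ha⟩ := hP.exists_apply_mem he hp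
    exact ⟨a, Subtype.ext (hP.eq_of_mem (hfP a) hp (hf a).1 ha)⟩
  have hker : partSetoid e he hP = Setoid.ker fun a => (⟨f a, hfP a⟩ : P) := by
    ext a b
    rw [partSetoid_iff_of_mem hP (hfP a) (hf a).1, Setoid.ker_def, Subtype.mk.injEq]
    exact ⟨fun h => hP.eq_of_mem (hfP a) (hfP b) h (hf b).1, fun h => h ▸ (hf b).1⟩
  rw [hker, Nat.card_congr (Setoid.quotientKerEquivOfSurjective _ hsurj)]
  exact Nat.card_coe_set_eq P

/-- Every setoid comes from a partition. -/
lemma exists_partSetoid_eq (hinj : Function.Injective e) (he : Set.range e = S)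
    (r : Setoid α) : ∃ (P : Set (Set β)) (hP : IsPartitionOf S P), partSetoid e he hP = r := by
  have hP : IsPartitionOf S (Set.range fun a => e '' {b | r a b}) := by
    refine ⟨?_, ?_, ?_⟩
    · rintro ⟨a, ha⟩
      exact Set.eq_empty_iff_forall_notMem.1 ha (e a) ⟨a, r.refl a, rfl⟩
    · rintro _ ⟨a, rfl⟩
      exact he ▸ Set.image_subset_range _ _
    · intro x hx
      obtain ⟨a, rfl⟩ := he.symm ▸ hx
      refine ⟨_, ⟨⟨a, rfl⟩, ⟨a, r.refl a, rfl⟩⟩, ?_⟩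
      rintro _ ⟨⟨b, rfl⟩, c, hbc, hca⟩
      obtain rfl := hinj hca
      refine congrArg (e '' ·) (Set.ext fun d => ?_)
      exact ⟨fun h => r.trans (r.symm hbc) h, fun h => r.trans hbc h⟩
  refine ⟨_, hP, ?_⟩
  ext a b
  rw [partSetoid_iff_of_mem hP ⟨a, rfl⟩ ⟨a, r.refl a, rfl⟩]
  exact hinj.mem_set_image

end Partitions

section CentralIdempotents

variable {G : Type} [Group G]

lemma linearIndependent_Irr [Fintype G] : LinearIndependent ℂ (Subtype.val : Irr G → G → ℂ) := by
  rw [linearIndependent_iff']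
  intro s c hc ψ hψ
  have hsum := congrArg (fun f : G → ℂ => ∑ g, f g * ψ.1 g⁻¹) hc
  simp only [Finset.sum_apply, Pi.smul_apply, smul_eq_mul, Finset.sum_mul, mul_assoc,
    Pi.zero_apply, zero_mul, Finset.sum_const_zero] at hsum
  rw [Finset.sum_comm] at hsum
  simp_rw [← Finset.mul_sum, sum_mul_inv_of_mem_Irr (Subtype.prop _) ψ.2, ← Subtype.ext_iff] at hsum
  simpa [hψ] using hsum

lemma finite_Irr [Fintype G] : Finite (Irr G) := linearIndependent_Irr.finite

variable [Fintype (Irr G)]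

/-- The class function `∑ χ, c χ * χ(1) * χ`. -/
noncomputable def charSum : (Irr G → ℂ) →ₗ[ℂ] (G → ℂ) where
  toFun c g := ∑ χ, c χ * (χ.1 1 * χ.1 g)
  map_add' c d := by ext g; simp [add_mul, Finset.sum_add_distrib]
  map_smul' a c := by ext g; simp [mul_assoc, Finset.mul_sum]

lemma charSum_apply (c : Irr G → ℂ) (g : G) :
    charSum c g = ∑ χ, c χ * (χ.1 1 * χ.1 g) := rfl

lemma sigmaChar_eq_charSum {X : Set (G → ℂ)} (hX : X ⊆ Irr G) :
    sigmaChar X = charSum (Set.indicator (Subtype.val ⁻¹' X) (1 : Irr G → ℂ)) := by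
  ext g
  have hrange : X = Subtype.val '' (Subtype.val ⁻¹' X : Set (Irr G)) := by
    simpa using hX
  rw [sigmaChar, charSum_apply]
  conv_lhs => rw [hrange]
  rw [finsum_mem_image Subtype.val_injective.injOn, finsum_mem_def, finsum_eq_sum_of_fintype]
  refine Finset.sum_congr rfl fun χ _ => ?_
  simp [Set.indicator_apply]

variable [Fintype G]

lemma charSum_conj (c : Irr G → ℂ) (g : G) :
    charSum (fun χ => (starRingEnd ℂ) (c χ)) g⁻¹ = (starRingEnd ℂ) (charSum c g) := by
  simp only [charSum_apply, map_sum, map_mul]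
  refine Finset.sum_congr rfl fun χ _ => ?_
  rw [← inv_eq_conj_of_mem_Irr χ.2, ← inv_eq_conj_of_mem_Irr χ.2, inv_one]

/-- The combination `∑ χ, c χ • e_χ` of central idempotents, as a linear map. -/
noncomputable def idemSumLinear : (Irr G → ℂ) →ₗ[ℂ] MonoidAlgebra ℂ G where
  toFun c := .ofCoeff (Finsupp.equivFunOnFinite.symm
    fun g => (Nat.card G : ℂ)⁻¹ * charSum c g⁻¹)
  map_add' c d := by ext g; simp [mul_add]
  map_smul' a c := by ext g; simp [mul_left_comm]

lemma coeff_idemSumLinear (c : Irr G → ℂ) (g : G) :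
    (idemSumLinear c).coeff g = (Nat.card G : ℂ)⁻¹ * charSum c g⁻¹ := rfl

lemma evalFun_idemSumLinear (ψ : Irr G) (c : Irr G → ℂ) :
    evalFun ψ.1 (idemSumLinear c) = c ψ * ψ.1 1 := by
  simp only [evalFun_apply, coeff_idemSumLinear, charSum_apply, Finset.mul_sum, Finset.sum_mul]
  rw [Finset.sum_comm]
  have hχ : ∀ χ : Irr G, ∑ g, (Nat.card G : ℂ)⁻¹ * (c χ * (χ.1 1 * χ.1 g⁻¹)) * ψ.1 g =
      if ψ = χ then c χ * χ.1 1 else 0 := by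
    intro χ
    calc _ = (Nat.card G : ℂ)⁻¹ * (c χ * χ.1 1) * ∑ g, ψ.1 g * χ.1 g⁻¹ := by
          rw [Finset.mul_sum]
          exact Finset.sum_congr rfl fun g _ => by ring
      _ = _ := by
          simp only [sum_mul_inv_of_mem_Irr ψ.2 χ.2, ← Subtype.ext_iff]
          split_ifs
          · rw [mul_comm, mul_inv_cancel_left₀ (by simp)]
          · rw [mul_zero]
  simp only [hχ, Finset.sum_ite_eq, Finset.mem_univ, if_true]

lemma idemSumLinear_mem_center (c : Irr G → ℂ) :
    idemSumLinear c ∈ Subalgebra.center ℂ (MonoidAlgebra ℂ G) := by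
  rw [mem_center_iff_coeff]
  intro g h
  simp only [coeff_idemSumLinear, charSum_apply]
  have : (h * g * h⁻¹)⁻¹ = h * g⁻¹ * h⁻¹ := by group
  simp [this, conj_mem_Irr (Subtype.prop _)]

/-- The combination `∑ χ, c χ • e_χ` of central idempotents, as an algebra homomorphism. -/
noncomputable def idemSum : (Irr G → ℂ) →ₐ[ℂ] MonoidAlgebra ℂ G :=
  AlgHom.ofLinearMap idemSumLinear
    (eq_of_evalFun_eq (idemSumLinear_mem_center _) (one_mem _) fun χ hχ => by
      rw [evalFun_idemSumLinear ⟨χ, hχ⟩]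
      simp [evalFun_apply, MonoidAlgebra.one_def, Finsupp.single_apply])
    fun c d => eq_of_evalFun_eq (idemSumLinear_mem_center _)
      (mul_mem (idemSumLinear_mem_center _) (idemSumLinear_mem_center _)) fun χ hχ => by
        apply mul_right_cancel₀ (apply_one_ne_zero_of_mem_Irr hχ)
        rw [evalFun_mul hχ (idemSumLinear_mem_center _) (idemSumLinear_mem_center _)]
        simp only [evalFun_idemSumLinear ⟨χ, hχ⟩, Pi.mul_apply]
        ring

lemma coeff_idemSum (c : Irr G → ℂ) (g : G) :
    (idemSum c).coeff g = (Nat.card G : ℂ)⁻¹ * charSum c g⁻¹ := rfl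

lemma charSum_eq_coeff_idemSum (c : Irr G → ℂ) (g : G) :
    charSum c g = Nat.card G * (idemSum c).coeff g⁻¹ := by
  rw [coeff_idemSum, inv_inv, mul_inv_cancel_left₀]
  simp

lemma idemSum_injective : Function.Injective (idemSum (G := G)) := by
  intro c d h
  ext ψ
  have := congrArg (evalFun ψ.1) h
  exact mul_right_cancel₀ (apply_one_ne_zero_of_mem_Irr ψ.2)
    ((evalFun_idemSumLinear ψ c).symm.trans (this.trans (evalFun_idemSumLinear ψ d)))

lemma charSum_injective : Function.Injective (charSum (G := G)) := by
  intro c d h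
  apply idemSum_injective
  ext g
  rw [coeff_idemSum, coeff_idemSum, h]

lemma range_idemSum : (idemSum (G := G)).range = Subalgebra.center ℂ (MonoidAlgebra ℂ G) := by
  ext z
  constructor
  · rintro ⟨c, rfl⟩
    exact idemSumLinear_mem_center c
  · intro hz
    refine ⟨fun χ => evalFun χ.1 z / χ.1 1, ?_⟩
    refine eq_of_evalFun_eq (idemSumLinear_mem_center _) hz fun χ hχ => ?_
    refine (evalFun_idemSumLinear ⟨χ, hχ⟩ _).trans ?_
    exact div_mul_cancel₀ _ (apply_one_ne_zero_of_mem_Irr hχ)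

end CentralIdempotents

section SchurRings

variable {G : Type} [Group G]

lemma coeff_ghat [Finite G] (K : Set G) (g : G) :
    (ghat K).coeff g = Set.indicator K (1 : G → ℂ) g := by
  have := Fintype.ofFinite G
  rw [ghat, finsum_mem_eq_finite_toFinset_sum _ K.toFinite, MonoidAlgebra.coeff_sum,
    Finsupp.finsetSum_apply]
  simp [Finsupp.single_apply, Set.indicator_apply]

/-- The group algebra of a finite group as the space of functions on the group. -/
noncomputable def coeffLinearEquivFun [Finite G] : MonoidAlgebra ℂ G ≃ₗ[ℂ] (G → ℂ) where
  toFun z := z.coeff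
  map_add' _ _ := rfl
  map_smul' _ _ := rfl
  invFun f := .ofCoeff (Finsupp.equivFunOnFinite.symm f)
  left_inv _ := by ext; rfl
  right_inv _ := rfl

/-- The relation of lying in the same part of a partition of `G`. -/
abbrev classSetoid {𝒦 : Set (Set G)} (h𝒦 : IsPartitionOf Set.univ 𝒦) : Setoid G :=
  partSetoid id Set.range_id h𝒦

/-- The relation of lying in the same part of a partition of `Irr G`. -/
abbrev charSetoid {𝒳 : Set (Set (G → ℂ))} (h𝒳 : IsPartitionOf (Irr G) 𝒳) : Setoid (Irr G) :=
  partSetoid Subtype.val Subtype.range_val h𝒳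

variable {𝒦 : Set (Set G)}

lemma map_span_ghat [Finite G] (h𝒦 : IsPartitionOf Set.univ 𝒦) :
    (Submodule.span ℂ ((fun K => ghat K) '' 𝒦)).map
      (coeffLinearEquivFun : MonoidAlgebra ℂ G ≃ₗ[ℂ] (G → ℂ)).toLinearMap =
      Subalgebra.toSubmodule (constOn (classSetoid h𝒦)) := by
  have hghat : ∀ K, (coeffLinearEquivFun : MonoidAlgebra ℂ G ≃ₗ[ℂ] (G → ℂ)) (ghat K) =
      Set.indicator K 1 := fun K => funext (coeff_ghat K)
  apply le_antisymm
  · rw [Submodule.map_span_le]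
    rintro _ ⟨K, hK, rfl⟩
    obtain ⟨a, ha⟩ := h𝒦.nonempty hK
    have hKa : K = {b | classSetoid h𝒦 a b} :=
      Set.ext fun b => (partSetoid_iff_of_mem (e := id) (he := Set.range_id) h𝒦 hK ha b).symm
    simp only [LinearEquiv.coe_coe, hghat]
    rw [hKa]
    exact indicator_mem_constOn _ a
  · intro f hf
    refine mem_of_indicator_mem (fun a => ?_) hf
    obtain ⟨K, hK, hKa⟩ := h𝒦.exists_eq_setOf Set.range_id a
    rw [hKa, Set.preimage_id, ← hghat]
    exact Submodule.mem_map_of_mem (Submodule.subset_span ⟨K, hK, rfl⟩)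

lemma mem_span_ghat [Finite G] (h𝒦 : IsPartitionOf Set.univ 𝒦)
    (z : MonoidAlgebra ℂ G) :
    z ∈ Submodule.span ℂ ((fun K => ghat K) '' 𝒦) ↔
      (z.coeff : G → ℂ) ∈ constOn (classSetoid h𝒦) := by
  rw [← Subalgebra.mem_toSubmodule, ← map_span_ghat h𝒦]
  exact ((coeffLinearEquivFun (G := G)).injective.mem_set_image).symm

lemma finrank_span_ghat [Finite G] (h𝒦 : IsPartitionOf Set.univ 𝒦) :
    Module.finrank ℂ (Submodule.span ℂ ((fun K => ghat K) '' 𝒦)) = 𝒦.ncard := by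
  rw [← LinearEquiv.finrank_map_eq coeffLinearEquivFun, map_span_ghat h𝒦,
    ← card_quotient_partSetoid (e := id) (he := Set.range_id) h𝒦]
  exact finrank_constOn _

lemma linearIndependent_ghat [Finite G] (h𝒦 : IsPartitionOf Set.univ 𝒦) :
    LinearIndependent ℂ (fun K : 𝒦 => ghat (K : Set G)) := by
  have := Fintype.ofFinite 𝒦
  rw [linearIndependent_iff_card_eq_finrank_span, Set.finrank, ← Set.image_eq_range]
  rw [finrank_span_ghat h𝒦, ← Nat.card_coe_set_eq, Nat.card_eq_fintype_card]

lemma inv_image_mem_of_forall_mem_constOn (h𝒦 : IsPartitionOf Set.univ 𝒦)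
    (h : ∀ f ∈ constOn (classSetoid h𝒦), (fun g => f g⁻¹) ∈ constOn (classSetoid h𝒦))
    {K : Set G} (hK : K ∈ 𝒦) : (fun g => g⁻¹) '' K ∈ 𝒦 := by
  have hrel : ∀ a b, classSetoid h𝒦 a b → classSetoid h𝒦 a⁻¹ b⁻¹ := by
    intro a b hab
    rw [rel_iff_forall_mem_constOn]
    exact fun f hf => h f hf a b hab
  obtain ⟨a, ha⟩ := h𝒦.nonempty hK
  obtain ⟨L, hL, haL, -⟩ := (classSetoid h𝒦).refl a⁻¹
  suffices (fun g => g⁻¹) '' K = L from this ▸ hL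
  ext b
  rw [Set.image_inv_eq_inv, Set.mem_inv]
  have hKb : classSetoid h𝒦 a b⁻¹ ↔ b⁻¹ ∈ K := partSetoid_iff_of_mem (e := id) h𝒦 hK ha b⁻¹
  have hLb : classSetoid h𝒦 a⁻¹ b ↔ b ∈ L := partSetoid_iff_of_mem (e := id) h𝒦 hL haL b
  rw [← hKb, ← hLb]
  exact ⟨fun hab => by simpa using hrel _ _ hab, fun hab => by simpa using hrel _ _ hab⟩

lemma inv_mem_constOn_of_inv_image_mem (h𝒦 : IsPartitionOf Set.univ 𝒦)
    (h : ∀ K ∈ 𝒦, (fun g => g⁻¹) '' K ∈ 𝒦) {f : G → ℂ}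
    (hf : f ∈ constOn (classSetoid h𝒦)) : (fun g => f g⁻¹) ∈ constOn (classSetoid h𝒦) := by
  rintro a b ⟨K, hK, ha, hb⟩
  exact hf _ _ ⟨_, h K hK, ⟨a, ha, rfl⟩, ⟨b, hb, rfl⟩⟩

variable [Fintype G] [Fintype (Irr G)] {𝒳 : Set (Set (G → ℂ))}

namespace IsSCT

/-- The supercharacters span the functions constant on superclasses. -/
lemma map_charSum (h : IsSCT G 𝒳 𝒦) :
    (Subalgebra.toSubmodule (constOn (charSetoid h.1))).map charSum =
      Subalgebra.toSubmodule (constOn (classSetoid h.2.1)) := by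
  obtain ⟨h𝒳, h𝒦, hcard, -, hσ⟩ := h
  apply Submodule.eq_of_le_of_finrank_eq
  · rw [Submodule.map_le_iff_le_comap]
    intro c hc
    refine mem_of_indicator_mem (fun χ => ?_) hc
    obtain ⟨X, hX, hXχ⟩ := h𝒳.exists_eq_setOf Subtype.range_val χ
    rw [hXχ, Submodule.mem_comap, ← sigmaChar_eq_charSum (h𝒳.2.1 X hX)]
    rintro g k ⟨K, hK, hg, hk⟩
    exact hσ X hX K hK g hg k hk
  · rw [← (Submodule.equivMapOfInjective _ charSum_injective _).finrank_eq]
    refine (finrank_constOn _).trans (Eq.trans ?_ (finrank_constOn _).symm)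
    rw [card_quotient_partSetoid, card_quotient_partSetoid, hcard]

lemma inv_mem_constOn (h : IsSCT G 𝒳 𝒦) {f : G → ℂ}
    (hf : f ∈ constOn (classSetoid h.2.1)) :
    (fun g => f g⁻¹) ∈ constOn (classSetoid h.2.1) := by
  rw [← Subalgebra.mem_toSubmodule, ← h.map_charSum] at hf
  obtain ⟨c, hc, rfl⟩ := hf
  have hconj : charSum (fun χ => (starRingEnd ℂ) (c χ)) ∈ constOn (classSetoid h.2.1) := by
    rw [← Subalgebra.mem_toSubmodule, ← h.map_charSum]
    exact Submodule.mem_map_of_mem fun χ ψ hχψ => congrArg _ (hc χ ψ hχψ)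
  intro a b hab
  have hval := hconj a b hab
  have hinv : ∀ g, charSum c g⁻¹ =
      (starRingEnd ℂ) (charSum (fun χ => (starRingEnd ℂ) (c χ)) g) := by
    intro g
    rw [← charSum_conj]
    simp
  simp only [hinv, hval]

/-- The span of the superclass sums is the span of the sums of central idempotents over the
parts of the character partition. -/
lemma map_idemSum (h : IsSCT G 𝒳 𝒦) :
    Subalgebra.toSubmodule ((constOn (charSetoid h.1)).map idemSum) =
      Submodule.span ℂ ((fun K => ghat K) '' 𝒦) := by
  have hcard : (Nat.card G : ℂ) ≠ 0 := by simp
  ext z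
  rw [mem_span_ghat h.2.1, Subalgebra.mem_toSubmodule]
  constructor
  · rintro ⟨c, hc, rfl⟩
    have hmem : charSum c ∈ constOn (classSetoid h.2.1) := by
      rw [← Subalgebra.mem_toSubmodule, ← h.map_charSum]
      exact Submodule.mem_map_of_mem hc
    exact Subalgebra.smul_mem _ (h.inv_mem_constOn hmem) (Nat.card G : ℂ)⁻¹
  · intro hz
    have hmem := Subalgebra.smul_mem _ (h.inv_mem_constOn hz) (Nat.card G : ℂ)
    rw [← Subalgebra.mem_toSubmodule, ← h.map_charSum] at hmem
    obtain ⟨c, hc, hcz⟩ := hmem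
    refine ⟨c, hc, ?_⟩
    ext g
    refine (coeff_idemSum c g).trans ?_
    rw [hcz]
    simp [-Nat.card_eq_fintype_card, hcard]

lemma isSchurRing_span (h : IsSCT G 𝒳 𝒦) :
    IsSchurRing (Submodule.span ℂ ((fun K => ghat K) '' 𝒦) : Set (MonoidAlgebra ℂ G)) := by
  refine ⟨⟨((constOn (charSetoid h.1)).map idemSum).toSubring, ?_⟩, 𝒦, h.2.1,
    linearIndependent_ghat h.2.1, rfl, h.2.2.2.1, fun K hK =>
      inv_image_mem_of_forall_mem_constOn h.2.1 (fun f hf => h.inv_mem_constOn hf) hK⟩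
  rw [← h.map_idemSum]
  rfl

lemma span_subset_center (h : IsSCT G 𝒳 𝒦) :
    (Submodule.span ℂ ((fun K => ghat K) '' 𝒦) : Set (MonoidAlgebra ℂ G)) ⊆
      Subalgebra.center ℂ (MonoidAlgebra ℂ G) := by
  rw [← h.map_idemSum, ← range_idemSum]
  rintro _ ⟨c, -, rfl⟩
  exact ⟨c, rfl⟩

lemma eq_of_span_eq {𝒳' : Set (Set (G → ℂ))} {𝒦' : Set (Set G)} (h : IsSCT G 𝒳 𝒦)
    (h' : IsSCT G 𝒳' 𝒦') (heq : Submodule.span ℂ ((fun K => ghat K) '' 𝒦) =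
      Submodule.span ℂ ((fun K => ghat K) '' 𝒦')) : 𝒳 = 𝒳' ∧ 𝒦 = 𝒦' := by
  constructor
  · rw [← h.map_idemSum, ← h'.map_idemSum] at heq
    exact eq_of_partSetoid_eq h.1 h'.1 (constOn_injective
      (Subalgebra.map_injective idemSum_injective (Subalgebra.toSubmodule_injective heq)))
  · refine eq_of_partSetoid_eq (e := id) (he := Set.range_id) h.2.1 h'.2.1 (constOn_injective
      (Subalgebra.toSubmodule_injective ?_))
    rw [← map_span_ghat h.2.1, ← map_span_ghat h'.2.1, heq]

end IsSCT

lemma IsSchurRing.exists_isSCT {A : Set (MonoidAlgebra ℂ G)} (hA : IsSchurRing A)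
    (hcenter : A ⊆ Subalgebra.center ℂ (MonoidAlgebra ℂ G)) :
    ∃ 𝒳 𝒦, IsSCT G 𝒳 𝒦 ∧
      (Submodule.span ℂ ((fun K => ghat K) '' 𝒦) : Set (MonoidAlgebra ℂ G)) = A := by
  obtain ⟨⟨S, hS⟩, 𝒦, h𝒦, -, hspan, hone, hinv⟩ := hA
  have hmemS : ∀ z, z ∈ S ↔ z ∈ Submodule.span ℂ ((fun K => ghat K) '' 𝒦) := fun z => by
    rw [← SetLike.mem_coe, ← SetLike.mem_coe, hS, hspan]
  let B : Subalgebra ℂ (MonoidAlgebra ℂ G) :=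
    { S with
      algebraMap_mem' := fun c => by
        change _ ∈ S
        rw [Algebra.algebraMap_eq_smul_one, hmemS]
        exact Submodule.smul_mem _ c ((hmemS 1).1 S.one_mem) }
  have hB : Subalgebra.toSubmodule B = Submodule.span ℂ ((fun K => ghat K) '' 𝒦) :=
    Submodule.ext hmemS
  have hBcenter : B ≤ (idemSum (G := G)).range := by
    rw [range_idemSum]
    intro z hz
    exact hcenter (hS ▸ hz)
  obtain ⟨r, hr⟩ := exists_constOn_eq (B.comap idemSum)
  obtain ⟨𝒳, h𝒳, rfl⟩ := exists_partSetoid_eq Subtype.val_injective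
    (Subtype.range_val (s := Irr G)) r
  have hmap : (constOn (charSetoid h𝒳)).map idemSum = B := by
    rw [hr, Subalgebra.map_comap_eq_self hBcenter]
  refine ⟨𝒳, 𝒦, ⟨h𝒳, h𝒦, ?_, hone, ?_⟩, hspan.symm⟩
  · rw [← finrank_span_ghat h𝒦, ← hB, ← hmap,
      ← card_quotient_partSetoid (he := Subtype.range_val) h𝒳, ← finrank_constOn]
    exact (Submodule.equivMapOfInjective (idemSum (G := G)).toLinearMap idemSum_injective
      (Subalgebra.toSubmodule (constOn (charSetoid h𝒳)))).finrank_eq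
  · intro X hX K hK g hg k hk
    obtain ⟨χ, hχ⟩ := h𝒳.exists_apply_mem Subtype.range_val hX
    have hXχ : (Subtype.val ⁻¹' X : Set (Irr G)) = {ψ | charSetoid h𝒳 χ ψ} :=
      Set.ext fun ψ => (partSetoid_iff_of_mem (he := Subtype.range_val) h𝒳 hX hχ ψ).symm
    have hmem : idemSum (Set.indicator (Subtype.val ⁻¹' X) (1 : Irr G → ℂ)) ∈
        Subalgebra.toSubmodule B := by
      rw [Subalgebra.mem_toSubmodule, ← hmap, hXχ]
      exact ⟨_, indicator_mem_constOn _ χ, rfl⟩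
    rw [hB, mem_span_ghat h𝒦] at hmem
    rw [sigmaChar_eq_charSum (h𝒳.2.1 X hX), charSum_eq_coeff_idemSum, charSum_eq_coeff_idemSum]
    congr 1
    exact inv_mem_constOn_of_inv_image_mem h𝒦 hinv hmem g k ⟨K, hK, hg, hk⟩

end SchurRings

/-- Proposition 2.4. The map `(𝒳,𝒦) ↦ span_ℂ{K̂ : K ∈ 𝒦}` is a
bijection from the supercharacter theories of `G` onto the Schur rings of `G` contained
in the center of `ℂ[G]`. -/
theorem stmt1 (G : Type) [Group G] [Finite G] :
    Set.BijOn
      (fun p : Set (Set (G → ℂ)) × Set (Set G) =>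
        (↑(Submodule.span ℂ ((fun K => ghat K) '' p.2)) : Set (MonoidAlgebra ℂ G)))
      {p | IsSCT G p.1 p.2}
      {A | IsSchurRing A ∧ A ⊆ ↑(Subalgebra.center ℂ (MonoidAlgebra ℂ G))} := by
  have := Fintype.ofFinite G
  have := finite_Irr (G := G)
  have := Fintype.ofFinite (Irr G)
  refine ⟨fun p hp => ⟨hp.isSchurRing_span, hp.span_subset_center⟩, ?_, ?_⟩
  · intro p hp q hq heq
    obtain ⟨h𝒳, h𝒦⟩ := hp.eq_of_span_eq hq (SetLike.coe_injective heq)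
    exact Prod.ext h𝒳 h𝒦
  · rintro A ⟨hA, hcenter⟩
    obtain ⟨𝒳, 𝒦, h, hspan⟩ := hA.exists_isSCT hcenter
    exact ⟨(𝒳, 𝒦), h, hspan⟩
end

section
/- Let N be a normal subgroup of a finite group G and let X ⊆ Irr(N) be a union of orbits under the conjugation action of G on Irr(N). Then σ_{X^G} = (σ_X)^G, i.e., the character σ of the set X^G ⊆ Irr(G) equals the induced character of σ_X from N to G. -/
open scoped Classical

open CategoryTheory Representation

section CharacterTheory

variable {G : Type} [Group G]

/-- Complex conjugation inverts the argument of a character of a finite group. -/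
theorem star_character [Fintype G] (V : FDRep ℂ G) (g : G) :
    (starRingEnd ℂ) (V.character g) = V.character g⁻¹ := by
  let b := Module.finBasis ℂ V
  let A : G → Matrix _ _ ℂ := fun x => LinearMap.toMatrix b b (V.ρ x)
  have hA : ∀ x y, A (x * y) = A x * A y := fun x y => by
    simp only [A, map_mul, LinearMap.toMatrix_mul]
  have hA1 : A 1 = 1 := by simp [A]
  have htr : ∀ x, V.character x = (A x).trace := fun x =>
    LinearMap.trace_eq_matrix_trace ℂ b (V.ρ x)
  open scoped ComplexOrder Matrix in
  have hunit : IsUnit (∑ x : G, (A x)ᴴ * A x) := by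
    refine Matrix.PosDef.isUnit ?_
    rw [← Finset.add_sum_erase _ _ (Finset.mem_univ (1 : G))]
    refine Matrix.PosDef.add_posSemidef ?_
      (Matrix.posSemidef_sum _ fun x _ => Matrix.posSemidef_conjTranspose_mul_self _)
    simpa [hA1] using Matrix.PosDef.one
  open scoped Matrix in
  obtain ⟨M, hM⟩ := hunit
  open scoped Matrix in
  have hinv : (A g)ᴴ * M * A g = M := by
    rw [hM, Finset.mul_sum, Finset.sum_mul]
    refine Fintype.sum_equiv (Equiv.mulRight g) _ _ fun x => ?_
    simp [hA, Matrix.conjTranspose_mul, mul_assoc]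
  open scoped Matrix in
  have hconj : (A g)ᴴ = M * A g⁻¹ * (M⁻¹ : (Matrix _ _ ℂ)ˣ) := by
    rw [Units.eq_mul_inv_iff_mul_eq]
    calc (A g)ᴴ * M = (A g)ᴴ * M * (A g * A g⁻¹) := by
          rw [← hA, mul_inv_cancel, hA1, mul_one]
      _ = M * A g⁻¹ := by rw [← mul_assoc, hinv]
  rw [htr, htr, starRingEnd_apply, ← Matrix.trace_conjTranspose, hconj, Matrix.trace_units_conj]

theorem cInner_eq_sum [Fintype G] (α β : G → ℂ) :
    cInner G α β = (Nat.card G : ℂ)⁻¹ * ∑ g, α g * (starRingEnd ℂ) (β g) := by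
  rw [cInner, finsum_eq_sum_of_fintype]

theorem cInner_character [Fintype G] (V W : FDRep ℂ G) :
    cInner G V.character W.character =
      Module.finrank ℂ (IntertwiningMap W.ρ V.ρ) := by
  have := invertibleOfNonzero (NeZero.ne (Nat.card G : ℂ))
  rw [cInner_eq_sum, ← card_inv_mul_sum_char_mul_char_eq_finrank]
  simp only [star_character]
  rfl

theorem cInner_irr [Finite G] {χ ψ : G → ℂ} (hχ : χ ∈ Irr G) (hψ : ψ ∈ Irr G) :
    cInner G χ ψ = if χ = ψ then 1 else 0 := by
  have := Fintype.ofFinite G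
  have := invertibleOfNonzero (NeZero.ne (Nat.card G : ℂ))
  obtain ⟨V, hV, rfl⟩ := hχ
  obtain ⟨W, hW, rfl⟩ := hψ
  have h := FDRep.char_orthonormal V W
  rw [cInner_eq_sum]
  simp only [star_character]
  split_ifs with heq
  · rw [← heq, (FDRep.simple_iff_char_is_norm_one V).1 hV, inv_mul_cancel_of_invertible]
  · rw [h, if_neg]
    rintro ⟨i⟩
    exact heq (FDRep.char_iso i)

theorem irr_finite [Finite G] : (Irr G).Finite := by
  have := Fintype.ofFinite G
  refine LinearIndependent.setFinite (R := ℂ) ?_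
  rw [linearIndependent_iff']
  intro s c hc i hi
  have h : cInner G (∑ j ∈ s, c j • (j : G → ℂ)) i = ∑ j ∈ s, c j * cInner G j i := by
    simp only [cInner_eq_sum, Finset.sum_apply, Pi.smul_apply, smul_eq_mul, Finset.sum_mul]
    rw [Finset.sum_comm, Finset.mul_sum]
    refine Finset.sum_congr rfl fun j _ => ?_
    simp only [Finset.mul_sum]
    exact Finset.sum_congr rfl fun g _ => by ring
  rw [hc, Finset.sum_eq_single i (fun j _ hj => by
    rw [cInner_irr j.2 i.2, if_neg (fun h => hj (Subtype.ext h)), mul_zero])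
    (fun h => absurd hi h), cInner_irr i.2 i.2, if_pos rfl, mul_one] at h
  rw [← h]
  simp [cInner_eq_sum]

/-- Schur's lemma for the action of a class function on a simple representation. -/
theorem exists_sum_smul_eq_smul_one [Fintype G] (V : FDRep ℂ G) [hV : Simple V] (a : G → ℂ)
    (ha : ∀ g h, a (g * h * g⁻¹) = a h) :
    ∃ c : ℂ, ∑ g, a g • V.ρ g = c • LinearMap.id ∧
      c * V.character 1 = ∑ g, a g * V.character g := by
  have hrank : Module.finrank ℂ (IntertwiningMap V.ρ V.ρ) = 1 := by
    have h := cInner_character V V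
    rw [cInner_irr ⟨V, hV, rfl⟩ ⟨V, hV, rfl⟩, if_pos rfl] at h
    exact_mod_cast h.symm
  have hcomm : ∀ g v, (∑ x, a x • V.ρ x) (V.ρ g v) = V.ρ g ((∑ x, a x • V.ρ x) v) := by
    intro g v
    simp only [LinearMap.sum_apply, LinearMap.smul_apply, map_sum, map_smul]
    refine Fintype.sum_equiv (MulAut.conj g⁻¹).toEquiv _ _ fun x => ?_
    have h1 : a (g⁻¹ * x * g) = a x := by simpa using ha g⁻¹ x
    simp [← mul_assoc, h1, ← Module.End.mul_apply, ← map_mul]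
  let T : IntertwiningMap V.ρ V.ρ :=
    LinearMap.intertwiningMap_of_isIntertwiningMap _ _ _ hcomm
  have : Nontrivial (IntertwiningMap V.ρ V.ρ) :=
    Module.nontrivial_of_finrank_pos (R := ℂ) (by omega)
  obtain ⟨c, hc⟩ := (finrank_eq_one_iff_of_nonzero' (1 : IntertwiningMap V.ρ V.ρ) one_ne_zero).1
    hrank T
  have hT : ∑ g, a g • V.ρ g = c • LinearMap.id :=
    (congrArg IntertwiningMap.toLinearMap hc).symm
  refine ⟨c, hT, ?_⟩
  have htr := congrArg (LinearMap.trace ℂ V) hT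
  simp only [map_sum, map_smul, smul_eq_mul, LinearMap.trace_id] at htr
  rw [FDRep.char_one]
  exact htr.symm

theorem character_one_ne_zero [Finite G] {χ : G → ℂ} (hχ : χ ∈ Irr G) : χ 1 ≠ 0 := by
  have := Fintype.ofFinite G
  have h := cInner_irr hχ hχ
  rw [if_pos rfl] at h
  obtain ⟨V, hV, rfl⟩ := hχ
  rw [FDRep.char_one]
  intro h0
  have h0 : Module.finrank ℂ V = 0 := by exact_mod_cast h0
  have : Subsingleton V := Module.finrank_zero_iff.1 h0
  have hz : ∀ g, V.character g = 0 := fun g => by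
    rw [FDRep.character, Subsingleton.elim (V.ρ g) 0, map_zero]
  simp [cInner_eq_sum, hz] at h

/-- A simple left ideal of the group algebra is a simple representation of the group. -/
theorem simple_of_ofModule' [Fintype G]
    (S : Submodule (MonoidAlgebra ℂ G) (MonoidAlgebra ℂ G))
    [hS : IsSimpleModule (MonoidAlgebra ℂ G) S] :
    Simple (FDRep.of (ofModule' (k := ℂ) (G := G) S)) := by
  have hfin : Module.Finite ℂ S := inferInstance
  let ρ : Representation ℂ G S := ofModule' (k := ℂ) (G := G) S
  have hrank : Module.finrank ℂ (IntertwiningMap ρ ρ) = 1 := by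
    have : Nontrivial S := IsSimpleModule.nontrivial (MonoidAlgebra ℂ G) S
    refine (finrank_eq_one_iff_of_nonzero' (1 : IntertwiningMap ρ ρ) fun h => ?_).2 fun u => ?_
    · obtain ⟨v, hv⟩ := exists_ne (0 : S)
      exact hv (congrArg (fun u : IntertwiningMap ρ ρ => u v) h)
    · obtain ⟨c, hc⟩ := (IsSimpleModule.algebraMap_end_bijective_of_isAlgClosed
        (A := MonoidAlgebra ℂ G) (V := S) ℂ).2
        (MonoidAlgebra.equivariantOfLinearOfComm u.toLinearMap fun g v =>
          LinearMap.congr_fun (u.isIntertwining' g) v)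
      refine ⟨c, IntertwiningMap.ext (LinearMap.ext fun v => ?_)⟩
      exact LinearMap.congr_fun hc v
  have h := cInner_character (FDRep.of ρ) (FDRep.of ρ)
  rw [FDRep.of_ρ', hrank, Nat.cast_one, cInner_eq_sum, inv_mul_eq_one₀ (NeZero.ne _)] at h
  rw [FDRep.simple_iff_char_is_norm_one, h]
  simp only [star_character]
  rfl

/-- A class function orthogonal to all irreducible characters vanishes. -/
theorem eq_zero_of_sum_mul_irr_eq_zero [Fintype G] (f : G → ℂ)
    (hf : ∀ g h, f (g * h * g⁻¹) = f h) (h : ∀ χ ∈ Irr G, ∑ g, f g * χ g = 0) : f = 0 := by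
  let z : MonoidAlgebra ℂ G := ∑ g, MonoidAlgebra.single g (f g)
  have hsimple : ∀ S : Submodule (MonoidAlgebra ℂ G) (MonoidAlgebra ℂ G),
      IsSimpleModule (MonoidAlgebra ℂ G) S → ∀ s ∈ S, z * s = 0 := by
    intro S hS s hs
    let V : FDRep ℂ G := FDRep.of (ofModule' (k := ℂ) (G := G) S)
    have hV : Simple V := simple_of_ofModule' S
    obtain ⟨c, hc, hc'⟩ := exists_sum_smul_eq_smul_one V f hf
    rw [h _ ⟨V, hV, rfl⟩] at hc'
    rw [(mul_eq_zero.1 hc').resolve_right (character_one_ne_zero ⟨V, hV, rfl⟩), zero_smul] at hc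
    have hs0 : ∑ g, f g • (MonoidAlgebra.single g (1 : ℂ) • (⟨s, hs⟩ : S)) = 0 := by
      have := LinearMap.congr_fun hc (⟨s, hs⟩ : S)
      rw [LinearMap.sum_apply] at this
      exact this
    have hs1 := congrArg Subtype.val hs0
    rw [Submodule.coe_sum, Submodule.coe_zero] at hs1
    rw [← hs1, Finset.sum_mul]
    refine Finset.sum_congr rfl fun g _ => ?_
    change _ = f g • (MonoidAlgebra.single g (1 : ℂ) * s)
    rw [← smul_mul_assoc, MonoidAlgebra.smul_single, smul_eq_mul, mul_one]
  have hmem : (1 : MonoidAlgebra ℂ G) ∈ sSup {S : Submodule (MonoidAlgebra ℂ G)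
      (MonoidAlgebra ℂ G) | IsSimpleModule (MonoidAlgebra ℂ G) S} := by
    rw [IsSemisimpleModule.sSup_simples_eq_top]
    trivial
  rw [sSup_eq_iSup'] at hmem
  have hz : z * 1 = 0 := Submodule.iSup_induction _ (motive := fun x => z * x = 0) hmem
    (fun S => hsimple S.1 S.2) (mul_zero z) fun x y hx hy => by rw [mul_add, hx, hy, add_zero]
  rw [mul_one] at hz
  funext g
  have hg := congrArg (fun w : MonoidAlgebra ℂ G => w.coeff g) hz
  simpa [z, Finsupp.single_apply] using hg

/-- Two class functions with the same inner products with all irreducible characters agree. -/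
theorem eq_of_cInner_irr_eq [Finite G] {α β : G → ℂ}
    (hα : ∀ g h, α (g * h * g⁻¹) = α h) (hβ : ∀ g h, β (g * h * g⁻¹) = β h)
    (h : ∀ χ ∈ Irr G, cInner G α χ = cInner G β χ) : α = β := by
  have := Fintype.ofFinite G
  have hzero := eq_zero_of_sum_mul_irr_eq_zero (fun g => (starRingEnd ℂ) (α g - β g))
    (fun g h => by simp only [hα, hβ]) fun χ hχ => by
      have hχ' := h χ hχ
      rw [cInner_eq_sum, cInner_eq_sum] at hχ'
      have hsum := mul_left_cancel₀ (inv_ne_zero (NeZero.ne (Nat.card G : ℂ))) hχ'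
      rw [← sub_eq_zero, ← Finset.sum_sub_distrib] at hsum
      simpa [sub_mul] using congrArg (starRingEnd ℂ) hsum
  funext g
  exact sub_eq_zero.1 ((map_eq_zero (starRingEnd ℂ)).1 (congrFun hzero g))

theorem irr_conj_apply {χ : G → ℂ} (hχ : χ ∈ Irr G) (g h : G) : χ (g * h * g⁻¹) = χ h := by
  obtain ⟨V, -, rfl⟩ := hχ
  exact V.char_conj h g

theorem irr_one_star {χ : G → ℂ} (hχ : χ ∈ Irr G) : (starRingEnd ℂ) (χ 1) = χ 1 := by
  obtain ⟨V, -, rfl⟩ := hχ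
  simp

theorem cInner_star_swap (α β : G → ℂ) [Finite G] :
    (starRingEnd ℂ) (cInner G α β) = cInner G β α := by
  have := Fintype.ofFinite G
  simp [cInner_eq_sum, mul_comm]

theorem cInner_sigmaChar [Finite G] {X : Set (G → ℂ)} (hX : X ⊆ Irr G) (β : G → ℂ) :
    cInner G (sigmaChar X) β = ∑ᶠ ψ ∈ X, ψ 1 * cInner G ψ β := by
  have := Fintype.ofFinite G
  have hfin : X.Finite := irr_finite.subset hX
  simp only [cInner_eq_sum, sigmaChar, finsum_mem_eq_finite_toFinset_sum _ hfin, Finset.sum_mul]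
  rw [Finset.sum_comm, Finset.mul_sum]
  refine Finset.sum_congr rfl fun ψ _ => ?_
  simp only [Finset.mul_sum]
  exact Finset.sum_congr rfl fun g _ => by ring

theorem cInner_sigmaChar_irr [Finite G] {X : Set (G → ℂ)} (hX : X ⊆ Irr G) {χ : G → ℂ}
    (hχ : χ ∈ Irr G) : cInner G (sigmaChar X) χ = if χ ∈ X then χ 1 else 0 := by
  rw [cInner_sigmaChar hX]
  have h : ∀ ψ ∈ X, ψ 1 * cInner G ψ χ = if ψ = χ then χ 1 else 0 := fun ψ hψ => by
    rw [cInner_irr (hX hψ) hχ]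
    split_ifs with heq <;> simp [heq]
  rw [finsum_mem_congr rfl h, finsum_mem_eq_finite_toFinset_sum _ (irr_finite.subset hX)]
  simp

theorem sigmaChar_conj {X : Set (G → ℂ)} (hX : X ⊆ Irr G) (g h : G) :
    sigmaChar X (g * h * g⁻¹) = sigmaChar X h :=
  finsum_mem_congr rfl fun ψ hψ => by rw [irr_conj_apply (hX hψ)]

end CharacterTheory

section NormalSubgroup

variable {G : Type} [Group G] {N : Subgroup G}

theorem sum_zeroExtend_smul [Fintype G] {M : Type*} [AddCommGroup M] [Module ℂ M]
    (a : N → ℂ) (F : G → M) : ∑ g, zeroExtend N a g • F g = ∑ n : N, a n • F n := by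
  have h : ∀ n : N, a n • F n = zeroExtend N a n • F n := fun n => by
    simp [zeroExtend]
  simp only [h]
  symm
  refine Finset.sum_of_injOn (fun n : N => (n : G)) Subtype.val_injective.injOn (by simp)
    (fun g _ hg => ?_) fun _ _ => rfl
  have hg' : g ∉ N := fun hm => hg ⟨⟨g, hm⟩, by simp, rfl⟩
  simp [zeroExtend, hg']

theorem sigmaChar_conjSub (hN : N.Normal) {X : Set (N → ℂ)}
    (horb : ∀ g : G, ∀ ψ ∈ X, charConj hN g ψ ∈ X) (g : G) (n : N) :
    sigmaChar X (conjSub hN g n) = sigmaChar X n := by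
  have hcancel : ∀ (x : G) (ψ : N → ℂ), charConj hN x (charConj hN x⁻¹ ψ) = ψ := fun x ψ => by
    funext m
    simp [charConj, conjSub, mul_assoc]
  refine finsum_mem_eq_of_bijOn (charConj hN g⁻¹) ⟨fun ψ hψ => horb _ ψ hψ, ?_, ?_⟩ ?_
  · intro ψ _ φ _ h
    rw [← hcancel g ψ, h, hcancel]
  · intro ψ hψ
    exact ⟨charConj hN g ψ, horb g ψ hψ, by simpa using hcancel g⁻¹ ψ⟩
  · intro ψ _
    have h1 : conjSub hN g 1 = 1 := Subtype.ext (by simp [conjSub])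
    simp [charConj, h1]

theorem zeroExtend_conj (hN : N.Normal) {a : N → ℂ} (ha : ∀ g n, a (conjSub hN g n) = a n)
    (g h : G) : zeroExtend N a (g * h * g⁻¹) = zeroExtend N a h := by
  by_cases hh : h ∈ N
  · simp only [zeroExtend, hh, hN.conj_mem h hh g, dif_pos]
    exact ha g ⟨h, hh⟩
  · have hh' : g * h * g⁻¹ ∉ N := fun hm => hh (by simpa [mul_assoc] using hN.conj_mem _ hm g⁻¹)
    simp only [zeroExtend, hh, hh', dif_neg, not_false_iff]

theorem indChar_eq [Finite G] (hN : N.Normal) {a : N → ℂ} (ha : ∀ g n, a (conjSub hN g n) = a n) :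
    indChar N a = fun g => (Nat.card N : ℂ)⁻¹ * (Nat.card G * zeroExtend N a g) := by
  have := Fintype.ofFinite G
  funext g
  have h : ∀ x : G, zeroExtend N a (x⁻¹ * g * x) = zeroExtend N a g := fun x => by
    simpa using zeroExtend_conj hN ha x⁻¹ g
  simp only [indChar, h, finsum_eq_sum_of_fintype]
  simp

theorem cInner_indChar [Finite G] (hN : N.Normal) {a : N → ℂ} (ha : ∀ g n, a (conjSub hN g n) = a n)
    (χ : G → ℂ) : cInner G (indChar N a) χ = cInner N a (resChar N χ) := by
  have := Fintype.ofFinite G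
  have h := sum_zeroExtend_smul a fun g => (starRingEnd ℂ) (χ g)
  simp only [smul_eq_mul] at h
  rw [cInner_eq_sum, cInner_eq_sum, indChar_eq hN ha]
  simp only [resChar, ← h, mul_assoc, ← Finset.mul_sum]
  rw [mul_left_comm, inv_mul_cancel_left₀ (NeZero.ne _)]

/-- If `χ` lies over some character in the conjugation-invariant set `X`, then all of `χ_N` is
accounted for by `X`. -/
theorem cInner_sigmaChar_resChar [Finite G] (hN : N.Normal) {X : Set (N → ℂ)} (hX : X ⊆ Irr N)
    (horb : ∀ g : G, ∀ ψ ∈ X, charConj hN g ψ ∈ X) {χ : G → ℂ} (hχ : χ ∈ indSet N X) :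
    cInner N (sigmaChar X) (resChar N χ) = χ 1 := by
  have := Fintype.ofFinite G
  simp only [indSet, Set.mem_iUnion] at hχ
  obtain ⟨ψ, hψ, hχ, hne⟩ := hχ
  obtain ⟨W, hW, rfl⟩ := hX hψ
  obtain ⟨V, hV, rfl⟩ := hχ
  let ρ : Representation ℂ N V := V.ρ.comp N.subtype
  let a : N → ℂ := fun n => (starRingEnd ℂ) (sigmaChar X n)
  have ha : ∀ g n, a (conjSub hN g n) = a n := fun g n => by
    simp only [a, sigmaChar_conjSub hN horb]
  have hres : resChar N V.character = (FDRep.of ρ).character := rfl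
  rw [hres, cInner_character, Nat.cast_ne_zero, ← Nat.pos_iff_ne_zero] at hne
  have := Module.nontrivial_of_finrank_pos hne
  obtain ⟨u, hu⟩ := exists_ne (0 : IntertwiningMap W.ρ (FDRep.of ρ).ρ)
  obtain ⟨w, hw⟩ : ∃ w, u w ≠ 0 := by
    by_contra! h
    exact hu (IntertwiningMap.ext (LinearMap.ext h))
  obtain ⟨c, hc, hctr⟩ := exists_sum_smul_eq_smul_one V (zeroExtend N a) (zeroExtend_conj hN ha)
  obtain ⟨d, hd, hdtr⟩ := exists_sum_smul_eq_smul_one W a fun g h => ha g h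
  have hdcard : d = Nat.card N := by
    have h := cInner_sigmaChar_irr hX ⟨W, hW, rfl⟩
    rw [if_pos hψ] at h
    have h' := congrArg (starRingEnd ℂ) h
    rw [cInner_star_swap, irr_one_star ⟨W, hW, rfl⟩, cInner_eq_sum,
      inv_mul_eq_iff_eq_mul₀ (NeZero.ne _)] at h'
    refine mul_right_cancel₀ (character_one_ne_zero ⟨W, hW, rfl⟩) (hdtr.trans (Eq.trans ?_ h'))
    exact Finset.sum_congr rfl fun n _ => mul_comm _ _
  have hcd : c = d := by
    rw [sum_zeroExtend_smul] at hc
    have h1 := LinearMap.congr_fun hc (u w)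
    have h2 := congrArg u (LinearMap.congr_fun hd w)
    simp only [LinearMap.sum_apply, LinearMap.smul_apply, map_sum, map_smul, LinearMap.id_apply,
      u.isIntertwining] at h1 h2
    exact smul_left_injective ℂ hw (h1.symm.trans h2)
  have htr := hctr
  simp only [← smul_eq_mul (a := zeroExtend N a _)] at htr
  rw [sum_zeroExtend_smul, hcd, hdcard] at htr
  rw [← cInner_star_swap, cInner_eq_sum]
  have hsum : ∑ n : N, resChar N V.character n * (starRingEnd ℂ) (sigmaChar X n) =
      Nat.card N * V.character 1 := by
    rw [htr]
    exact Finset.sum_congr rfl fun n _ => mul_comm _ _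
  rw [hsum, inv_mul_cancel_left₀ (NeZero.ne _), irr_one_star ⟨V, hV, rfl⟩]

theorem indSet_subset_irr (X : Set (N → ℂ)) : indSet N X ⊆ Irr G :=
  Set.iUnion₂_subset fun _ _ _ h => h.1

theorem cInner_sigmaChar_resChar_of_notMem [Finite G] {X : Set (N → ℂ)} (hX : X ⊆ Irr N) {χ : G → ℂ}
    (hχ : χ ∈ Irr G) (h : χ ∉ indSet N X) : cInner N (sigmaChar X) (resChar N χ) = 0 := by
  rw [cInner_sigmaChar hX]
  refine finsum_mem_eq_zero_of_forall_eq_zero fun ψ hψ => ?_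
  have h0 : cInner N (resChar N χ) ψ = 0 := by
    by_contra hne
    exact h (Set.mem_biUnion hψ ⟨hχ, hne⟩)
  rw [← cInner_star_swap, h0, map_zero, mul_zero]

end NormalSubgroup

/-- Lemma 4.1. If `N ⊴ G` and `X ⊆ Irr(N)` is a union of `G`-orbits
(i.e. closed under the conjugation action of `G`), then `σ_{X^G} = (σ_X)^G`. -/
theorem stmt7 (G : Type) [Group G] [Finite G] (N : Subgroup G) [hN : N.Normal]
    (X : Set (↥N → ℂ)) (hX : X ⊆ Irr ↥N)
    (horb : ∀ g : G, ∀ ψ ∈ X, charConj hN g ψ ∈ X) :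
    sigmaChar (indSet N X) = indChar N (sigmaChar X) := by
  have hinv := sigmaChar_conjSub hN horb
  refine eq_of_cInner_irr_eq (sigmaChar_conj (indSet_subset_irr X)) (fun g h => ?_) fun χ hχ => ?_
  · simp only [indChar_eq hN hinv, zeroExtend_conj hN hinv]
  · rw [cInner_sigmaChar_irr (indSet_subset_irr X) hχ, cInner_indChar hN hinv]
    split_ifs with h
    · exact (cInner_sigmaChar_resChar hN hX horb h).symm
    · exact (cInner_sigmaChar_resChar_of_notMem hX hχ h).symm
end

section
/- Let G be a finite group, let N ⊴ G be a normal subgroup, and let 𝒞 = (𝒳,𝒦) be a supercharacter theory of G. Then N is 𝒞-normal (i.e., a union of superclasses of 𝒞) if and only if the set Irr(G/N) := {χ ∈ Irr(G) : N ⊆ ker χ} is a union of parts of 𝒳. -/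
open scoped Classical

section Orthogonality

variable {G : Type} [Group G] [Fintype G]

/-- The bilinear pairing `|G|⁻¹ ∑ α(g) β(g⁻¹)`, as a linear form in `α`. -/
noncomputable def charForm (β : G → ℂ) : (G → ℂ) →ₗ[ℂ] ℂ :=
  (Nat.card G : ℂ)⁻¹ • ∑ g : G, β g⁻¹ • LinearMap.proj g

theorem charForm_apply (α β : G → ℂ) :
    charForm β α = (Nat.card G : ℂ)⁻¹ * ∑ g : G, α g * β g⁻¹ := by
  simp [charForm, mul_comm]

theorem charForm_self {ψ : G → ℂ} (hψ : ψ ∈ Irr G) : charForm ψ ψ = 1 := by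
  obtain ⟨V, hV, rfl⟩ := hψ
  rw [charForm_apply, (FDRep.simple_iff_char_is_norm_one V).1 hV]
  exact inv_mul_cancel₀ (NeZero.ne _)

theorem charForm_irr {φ ψ : G → ℂ} (hφ : φ ∈ Irr G) (hψ : ψ ∈ Irr G) :
    charForm φ ψ = if ψ = φ then 1 else 0 := by
  split_ifs with h
  · rw [h, charForm_self hφ]
  · obtain ⟨V, hV, rfl⟩ := hφ
    obtain ⟨W, hW, rfl⟩ := hψ
    have : Invertible (Nat.card G : ℂ) := invertibleOfNonzero (NeZero.ne _)
    rw [charForm_apply, FDRep.char_orthonormal W V, if_neg]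
    rintro ⟨i⟩
    exact h (FDRep.char_iso i)

theorem linearIndependent_irr : LinearIndependent ℂ (Subtype.val : Irr G → G → ℂ) := by
  rw [linearIndependent_iff']
  intro s c hc i hi
  have h := congrArg (charForm i.1) hc
  simpa [map_sum, charForm_irr i.2 (Subtype.prop _), Subtype.val_inj, hi] using h

variable (G) in
theorem finite_irr : (Irr G).Finite :=
  linearIndependent_irr.setFinite

theorem sigmaChar_eq_sum {X : Set (G → ℂ)} (hX : X ⊆ Irr G) :
    sigmaChar X = ∑ ψ ∈ ((finite_irr G).subset hX).toFinset, ψ 1 • ψ := by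
  ext g
  rw [sigmaChar, finsum_mem_eq_finite_toFinset_sum _ ((finite_irr G).subset hX)]
  simp

theorem charForm_sigmaChar {X : Set (G → ℂ)} (hX : X ⊆ Irr G) {φ : G → ℂ} (hφ : φ ∈ Irr G) :
    charForm φ (sigmaChar X) = if φ ∈ X then φ 1 else 0 := by
  rw [sigmaChar_eq_sum hX, map_sum, Finset.sum_congr rfl (g := fun ψ => if ψ = φ then ψ 1 else 0)]
  · simp
  · intro ψ hψ
    simp [charForm_irr hφ (hX (((finite_irr G).subset hX).mem_toFinset.1 hψ))]

theorem eq_sum_charForm_of_mem_span {f : G → ℂ} (hf : f ∈ Submodule.span ℂ (Irr G)) :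
    f = ∑ φ ∈ (finite_irr G).toFinset, charForm φ f • φ := by
  induction hf using Submodule.span_induction with
  | mem ψ hψ =>
    rw [Finset.sum_congr rfl (g := fun φ => if ψ = φ then φ else 0)]
    · simp [hψ]
    · intro φ hφ
      simp [charForm_irr ((finite_irr G).mem_toFinset.1 hφ) hψ]
  | zero => simp
  | add f g _ _ hf hg =>
    simp only [map_add, add_smul, Finset.sum_add_distrib]
    rw [← hf, ← hg]
  | smul c f _ hf =>
    simp only [map_smul, smul_assoc, ← Finset.smul_sum]
    rw [← hf]

theorem irr_one_ne_zero {ψ : G → ℂ} (hψ : ψ ∈ Irr G) : ψ 1 ≠ 0 := by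
  have h := charForm_self hψ
  obtain ⟨V, hV, rfl⟩ := hψ
  intro h0
  rw [FDRep.char_one, Nat.cast_eq_zero] at h0
  have : Subsingleton V := Module.finrank_zero_iff.1 h0
  have hz : V.character = 0 := by
    ext g
    simp [FDRep.character, Subsingleton.elim (V.ρ g) 0]
  simp [hz] at h

end Orthogonality

section Decomposition

variable {G : Type} [Group G]

theorem character_eq_add_of_isCompl {V : Type} [AddCommGroup V] [Module ℂ V]
    [FiniteDimensional ℂ V] {ρ : Representation ℂ G V} {U W : Subrepresentation ρ}
    (h : IsCompl U W) :
    ρ.character = U.toRepresentation.character + W.toRepresentation.character := by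
  have hUW : IsCompl U.toSubmodule W.toSubmodule := by
    refine IsCompl.of_eq ?_ ?_
    · exact congrArg Subrepresentation.toSubmodule h.inf_eq_bot
    · exact congrArg Subrepresentation.toSubmodule h.sup_eq_top
  ext g
  let F : Bool → Submodule ℂ V := fun b => cond b U.toSubmodule W.toSubmodule
  have hF : DirectSum.IsInternal F :=
    (DirectSum.isInternal_submodule_iff_isCompl F (i := true) (j := false) (by simp)
      (by ext b; cases b <;> simp)).2 hUW
  have hmaps : ∀ b, Set.MapsTo (ρ g) (F b) (F b) := by
    rintro (_ | _)
    · exact W.apply_mem_toSubmodule g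
    · exact U.apply_mem_toSubmodule g
  have key := LinearMap.trace_eq_sum_trace_restrict hF hmaps
  rw [Fintype.sum_bool] at key
  exact key

variable [Fintype G]

theorem character_mem_irr {V : Type} [AddCommGroup V] [Module ℂ V] [FiniteDimensional ℂ V]
    (ρ : Representation ℂ G V) [ρ.IsIrreducible] : ρ.character ∈ Irr G := by
  refine ⟨FDRep.of ρ, ?_, rfl⟩
  have : Invertible (Nat.card G : ℂ) := invertibleOfNonzero (NeZero.ne _)
  have h := Representation.char_orthonormal ρ ρ
  rw [if_pos ⟨Representation.Equiv.refl ρ⟩, inv_mul_eq_one₀ (NeZero.ne _)] at h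
  exact (FDRep.simple_iff_char_is_norm_one _).2 h.symm

theorem character_mem_span_irr (n : ℕ) : ∀ {V : Type} [AddCommGroup V] [Module ℂ V]
    [FiniteDimensional ℂ V] (ρ : Representation ℂ G V), Module.finrank ℂ V = n →
    ρ.character ∈ Submodule.span ℂ (Irr G) := by
  induction n using Nat.strong_induction_on with
  | _ n ih =>
  intro V _ _ _ ρ hn
  by_cases hirr : ρ.IsIrreducible
  · exact Submodule.subset_span (character_mem_irr ρ)
  rcases subsingleton_or_nontrivial V with hV | hV
  · have hz : ρ.character = 0 := by
      ext g
      simp [Representation.character, Subsingleton.elim (ρ g) 0]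
    simp [hz]
  have hnt : Nontrivial (Subrepresentation ρ) :=
    ⟨⊥, ⊤, fun h => bot_ne_top (α := Submodule ℂ V) (congrArg Subrepresentation.toSubmodule h)⟩
  obtain ⟨U, hU0, hU1⟩ : ∃ U : Subrepresentation ρ, U ≠ ⊥ ∧ U ≠ ⊤ := by
    by_contra! h
    exact hirr ⟨fun U => or_iff_not_imp_left.2 (h U)⟩
  have : NeZero (Nat.card G : ℂ) := ⟨NeZero.ne _⟩
  obtain ⟨W, hUW⟩ := exists_isCompl U
  have hW1 : W ≠ ⊤ := by
    rintro rfl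
    exact hU0 (eq_bot_of_isCompl_top hUW)
  have hlt : ∀ W : Subrepresentation ρ, W ≠ ⊤ → Module.finrank ℂ W.toSubmodule < n := by
    intro W hW
    rw [← hn]
    exact Submodule.finrank_lt (fun h => hW (Subrepresentation.toSubmodule_injective h))
  rw [character_eq_add_of_isCompl hUW]
  exact add_mem (ih _ (hlt U hU1) _ rfl) (ih _ (hlt W hW1) _ rfl)

/-- The indicator function of a subgroup. -/
noncomputable def subgroupIndicator (N : Subgroup G) : G → ℂ :=
  fun g => if g ∈ N then 1 else 0

/-- The permutation representation on functions on `G ⧸ N`. -/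
noncomputable def quotientRep (N : Subgroup G) : Representation ℂ G (G ⧸ N → ℂ) where
  toFun g := LinearMap.funLeft ℂ ℂ (g⁻¹ • ·)
  map_one' := by ext; simp [LinearMap.funLeft]
  map_mul' g h := by
    ext
    simp [LinearMap.funLeft, mul_smul]

theorem quotientRep_character (N : Subgroup G) [N.Normal] :
    (quotientRep N).character = (N.index : ℂ) • subgroupIndicator N := by
  ext g
  have hfix : ∀ x : G ⧸ N, g⁻¹ • x = x ↔ g ∈ N := by
    intro x
    obtain ⟨a, rfl⟩ := QuotientGroup.mk_surjective x
    rw [MulAction.Quotient.smul_mk, QuotientGroup.eq, smul_eq_mul, mul_inv_rev, inv_inv,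
      Subgroup.Normal.mem_comm_iff inferInstance, mul_inv_cancel_left]
  rw [Representation.character, LinearMap.trace_eq_matrix_trace ℂ (Pi.basisFun ℂ (G ⧸ N)),
    Matrix.trace]
  simp [quotientRep, LinearMap.funLeft, Pi.single_apply, hfix,
    subgroupIndicator, Subgroup.index, Nat.card_eq_fintype_card]

theorem subgroupIndicator_mem_span_irr (N : Subgroup G) [N.Normal] :
    subgroupIndicator N ∈ Submodule.span ℂ (Irr G) := by
  have h := character_mem_span_irr _ (quotientRep N) rfl
  rw [quotientRep_character] at h
  exact (Submodule.smul_mem_iff _ (Nat.cast_ne_zero.2 N.index_ne_zero_of_finite)).1 h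

end Decomposition

section Kernel

variable {G : Type} [Group G] [Fintype G] (N : Subgroup G)

theorem charForm_subgroupIndicator (φ : G → ℂ) :
    charForm φ (subgroupIndicator N) = (Nat.card G : ℂ)⁻¹ * ∑ n : N, φ n := by
  rw [charForm_apply, ← Equiv.sum_comp (Equiv.inv G)]
  simp only [subgroupIndicator, Equiv.inv_apply, inv_mem_iff, inv_inv, ite_mul, one_mul, zero_mul]
  rw [← Finset.sum_filter, Finset.sum_subtype _ (p := (· ∈ N)) (by simp)]

theorem sum_character_eq_finrank_invariants (V : FDRep ℂ G) :
    ∑ n : N, V.character n =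
      Nat.card N * Module.finrank ℂ (Representation.invariants (V.ρ.comp N.subtype)) := by
  have : Invertible (Nat.card N : ℂ) := invertibleOfNonzero (NeZero.ne _)
  rw [← Representation.card_inv_mul_sum_char_eq_finrank, mul_inv_cancel_left₀ (NeZero.ne _)]
  rfl

theorem mem_irrOver_iff_sum {φ : G → ℂ} (hφ : φ ∈ Irr G) :
    φ ∈ IrrOver N ↔ ∑ n : N, φ n = Nat.card N * φ 1 := by
  refine ⟨fun h => ?_, fun h => ⟨hφ, ?_⟩⟩
  · rw [Finset.sum_congr rfl fun (n : N) _ => h.2 n n.2]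
    simp [Nat.card_eq_fintype_card]
  · obtain ⟨V, hV, rfl⟩ := hφ
    rw [sum_character_eq_finrank_invariants, FDRep.char_one, mul_right_inj' (NeZero.ne _),
      Nat.cast_inj] at h
    have htop := Submodule.eq_top_of_finrank_eq h
    intro n hn
    have h1 : V.ρ n = V.ρ 1 := by
      ext v
      have hv : v ∈ Representation.invariants (V.ρ.comp N.subtype) := htop ▸ Submodule.mem_top
      simpa using hv ⟨n, hn⟩
    rw [FDRep.character, h1, FDRep.character]

theorem sum_eq_zero_of_notMem_irrOver [N.Normal] {φ : G → ℂ} (hφ : φ ∈ Irr G)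
    (hN : φ ∉ IrrOver N) : ∑ n : N, φ n = 0 := by
  have hirr := hφ
  have hnorm := charForm_self hφ
  obtain ⟨V, hV, rfl⟩ := hφ
  have : Invertible (Nat.card G : ℂ) := invertibleOfNonzero (NeZero.ne _)
  have hrank : Module.finrank ℂ (Representation.IntertwiningMap V.ρ V.ρ) = 1 := by
    rw [charForm_apply] at hnorm
    have h := Representation.card_inv_mul_sum_char_mul_char_eq_finrank V.ρ V.ρ
    exact_mod_cast h.symm.trans hnorm
  let f : Module.End ℂ V := ∑ n : N, V.ρ n
  have hcomm : ∀ g : G, f * V.ρ g = V.ρ g * f := by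
    intro g
    simp only [f, Finset.sum_mul, Finset.mul_sum, ← map_mul]
    rw [← Equiv.sum_comp (MulAut.conjNormal g).toEquiv]
    simp [MulAut.conjNormal_apply]
  have hinv : ∀ n ∈ N, V.ρ n * f = f := by
    intro n hn
    simp only [f, Finset.mul_sum, ← map_mul]
    exact Equiv.sum_comp (Equiv.mulLeft (⟨n, hn⟩ : N)) fun m : N => V.ρ m
  have htrace : LinearMap.trace ℂ V f = ∑ n : N, V.character n := by
    simp only [f, map_sum, FDRep.character]
  have hV0 : V.character 1 ≠ 0 := irr_one_ne_zero hirr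
  have hid : Representation.IntertwiningMap.id V.ρ ≠ 0 := by
    intro h
    have h1 : (1 : Module.End ℂ V) = 0 := congrArg Representation.IntertwiningMap.toLinearMap h
    rw [FDRep.character, map_one, h1, map_zero] at hV0
    exact hV0 rfl
  obtain ⟨c, hc⟩ := (finrank_eq_one_iff_of_nonzero' _ hid).1 hrank ⟨f, hcomm⟩
  have hfc : f = c • (1 : Module.End ℂ V) :=
    (congrArg Representation.IntertwiningMap.toLinearMap hc).symm
  by_cases hc0 : c = 0
  · rw [← htrace, hfc, hc0, zero_smul, map_zero]
  · refine absurd ⟨hirr, fun n hn => ?_⟩ hN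
    have h := hinv n hn
    rw [hfc, mul_smul_comm, mul_one] at h
    rw [FDRep.character, smul_right_injective _ hc0 h, FDRep.character, map_one V.ρ]

theorem sigmaChar_irrOver [N.Normal] :
    sigmaChar (IrrOver N) = (N.index : ℂ) • subgroupIndicator N := by
  have hsub : IrrOver N ⊆ Irr G := fun _ h => h.1
  rw [eq_sum_charForm_of_mem_span (subgroupIndicator_mem_span_irr N), sigmaChar_eq_sum hsub,
    Finset.smul_sum]
  refine Finset.sum_subset_zero_on_sdiff (by simpa using hsub) ?_ ?_
  · intro φ hφ
    simp only [Finset.mem_sdiff, Set.Finite.mem_toFinset] at hφ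
    simp [charForm_subgroupIndicator, sum_eq_zero_of_notMem_irrOver N hφ.1 hφ.2]
  · intro φ hφ
    rw [Set.Finite.mem_toFinset] at hφ
    rw [charForm_subgroupIndicator, (mem_irrOver_iff_sum N hφ.1).1 hφ, smul_smul,
      ← N.index_mul_card]
    congr 1
    have h1 : (N.index : ℂ) ≠ 0 := Nat.cast_ne_zero.2 N.index_ne_zero_of_finite
    have h2 : (Nat.card N : ℂ) ≠ 0 := NeZero.ne _
    push_cast
    field_simp

end Kernel

section SCT

variable {G : Type} [Group G] [Fintype G] {𝒳 : Set (Set (G → ℂ))} {𝒦 : Set (Set G)}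

theorem IsPartitionOf.pairwiseDisjoint {α : Type*} {S : Set α} {P : Set (Set α)}
    (h : IsPartitionOf S P) : P.PairwiseDisjoint id := by
  intro p hp q hq hpq
  refine Set.disjoint_left.2 fun a hap haq => hpq ?_
  exact (h.2.2 a (h.2.1 p hp hap)).unique ⟨hp, hap⟩ ⟨hq, haq⟩

theorem sUnion_parts_eq {α : Type*} {S A : Set α} {P : Set (Set α)} (hP : IsPartitionOf S P)
    (hA : A ⊆ S) (h : ∀ p ∈ P, ∀ a ∈ p, ∀ b ∈ p, a ∈ A → b ∈ A) :
    ∃ T ⊆ P, A = ⋃₀ T := by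
  refine ⟨{p ∈ P | p ⊆ A}, Set.sep_subset _ _, Set.Subset.antisymm (fun a ha => ?_)
    (Set.sUnion_subset fun p hp => hp.2)⟩
  obtain ⟨p, ⟨hp, hap⟩, -⟩ := hP.2.2 a (hA ha)
  exact ⟨p, ⟨hp, fun b hb => h p hp a hap b hb ha⟩, hap⟩

theorem sigmaChar_sUnion_eq (h : IsSCT G 𝒳 𝒦) {T : Set (Set (G → ℂ))} (hT : T ⊆ 𝒳)
    {K : Set G} (hK : K ∈ 𝒦) {x y : G} (hx : x ∈ K) (hy : y ∈ K) :
    sigmaChar (⋃₀ T) x = sigmaChar (⋃₀ T) y := by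
  have hfin : ∀ X ∈ T, X.Finite := fun X hX => (finite_irr G).subset (h.1.2.1 X (hT hX))
  have hTfin : T.Finite := ((finite_irr G).finite_subsets).subset fun X hX => h.1.2.1 X (hT hX)
  have hdisj : T.PairwiseDisjoint id := h.1.pairwiseDisjoint.subset hT
  simp only [sigmaChar]
  rw [finsum_mem_sUnion hdisj hTfin hfin, finsum_mem_sUnion hdisj hTfin hfin]
  exact finsum_mem_congr rfl fun X hX => h.2.2.2.2 X (hT hX) K hK x hx y hy

theorem linearIndependent_sigmaChar (h : IsPartitionOf (Irr G) 𝒳) :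
    LinearIndependent ℂ (fun X : 𝒳 => sigmaChar (X : Set (G → ℂ))) := by
  rw [linearIndependent_iff']
  intro s c hc X hX
  obtain ⟨φ, hφ⟩ : (X : Set (G → ℂ)).Nonempty :=
    Set.nonempty_iff_ne_empty.2 fun h0 => h.1 (h0 ▸ X.2)
  have hφi := h.2.1 X X.2 hφ
  have hmem : ∀ Y : 𝒳, φ ∈ (Y : Set (G → ℂ)) ↔ Y = X := fun Y =>
    ⟨fun hY => Subtype.ext ((h.2.2 φ hφi).unique ⟨Y.2, hY⟩ ⟨X.2, hφ⟩), fun hY => hY ▸ hφ⟩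
  have hz := congrArg (charForm φ) hc
  simp only [map_sum, map_smul, map_zero, charForm_sigmaChar (h.2.1 _ (Subtype.prop _)) hφi,
    hmem] at hz
  simpa [hX, irr_one_ne_zero hφi] using hz

/-- The functions constant on superclasses are spanned by the supercharacters. -/
theorem mem_span_sigmaChar (h : IsSCT G 𝒳 𝒦) {f : G → ℂ}
    (hf : ∀ K ∈ 𝒦, ∀ x ∈ K, ∀ y ∈ K, f x = f y) :
    f ∈ Submodule.span ℂ (Set.range fun X : 𝒳 => sigmaChar (X : Set (G → ℂ))) := by
  obtain ⟨hX, hK, hcard, -, hconst⟩ := h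
  choose cls hcls using fun g : G => (hK.2.2 g (Set.mem_univ g)).exists
  have hne : ∀ K : 𝒦, (K : Set G).Nonempty := fun K =>
    Set.nonempty_iff_ne_empty.2 fun h0 => hK.1 (h0 ▸ K.2)
  choose rep hrep using hne
  let L : (𝒦 → ℂ) →ₗ[ℂ] (G → ℂ) := LinearMap.funLeft ℂ ℂ fun g => (⟨cls g, (hcls g).1⟩ : 𝒦)
  have hL : ∀ u : G → ℂ, (∀ K ∈ 𝒦, ∀ x ∈ K, ∀ y ∈ K, u x = u y) →
      L (fun K => u (rep K)) = u := fun u hu =>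
    funext fun g => hu _ (hcls g).1 _ (hrep ⟨cls g, (hcls g).1⟩) _ (hcls g).2
  let τ : 𝒳 → 𝒦 → ℂ := fun X K => sigmaChar (X : Set (G → ℂ)) (rep K)
  have hτ : L ∘ τ = fun X : 𝒳 => sigmaChar (X : Set (G → ℂ)) :=
    funext fun X => hL _ (hconst X X.2)
  have hind : LinearIndependent ℂ τ :=
    LinearIndependent.of_comp L (hτ ▸ linearIndependent_sigmaChar hX)
  have : Finite 𝒳 := ((finite_irr G).finite_subsets).subset hX.2.1
  have : Fintype 𝒳 := Fintype.ofFinite _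
  have hspan : Submodule.span ℂ (Set.range τ) = ⊤ := by
    refine hind.span_eq_top_of_card_eq_finrank' ?_
    rw [Module.finrank_fintype_fun_eq_card, ← Nat.card_eq_fintype_card,
      ← Nat.card_eq_fintype_card]
    exact hcard
  have hmem := Submodule.mem_map_of_mem (f := L)
    (hspan ▸ Submodule.mem_top : (fun K => f (rep K)) ∈ Submodule.span ℂ (Set.range τ))
  rwa [hL f hf, Submodule.map_span, ← Set.range_comp, hτ] at hmem

/-- On each part of `𝒳`, the multiplicities in a combination of supercharacters are
proportional to the degrees. -/
theorem charForm_mul_one_eq (h : IsPartitionOf (Irr G) 𝒳) {f : G → ℂ}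
    (hf : f ∈ Submodule.span ℂ (Set.range fun X : 𝒳 => sigmaChar (X : Set (G → ℂ))))
    {X : Set (G → ℂ)} (hX : X ∈ 𝒳) {φ ψ : G → ℂ} (hφ : φ ∈ X) (hψ : ψ ∈ X) :
    charForm φ f * ψ 1 = charForm ψ f * φ 1 := by
  have hφi := h.2.1 X hX hφ
  have hψi := h.2.1 X hX hψ
  induction hf using Submodule.span_induction with
  | mem u hu =>
    obtain ⟨Y, rfl⟩ := hu
    have hiff : φ ∈ (Y : Set (G → ℂ)) ↔ ψ ∈ (Y : Set (G → ℂ)) := by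
      constructor <;> intro hY
      · rwa [(h.2.2 φ hφi).unique ⟨Y.2, hY⟩ ⟨hX, hφ⟩]
      · rwa [(h.2.2 ψ hψi).unique ⟨Y.2, hY⟩ ⟨hX, hψ⟩]
    simp only [charForm_sigmaChar (h.2.1 _ Y.2) hφi, charForm_sigmaChar (h.2.1 _ Y.2) hψi, hiff]
    split_ifs <;> ring
  | zero => simp
  | add u v _ _ hu hv => simp only [map_add, add_mul, hu, hv]
  | smul c u _ hu => simp only [map_smul, smul_eq_mul, mul_assoc, hu]

end SCT

/-- A normal subgroup `N ⊴ G` is `𝒞`-normal for a supercharacter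
theory `𝒞 = (𝒳,𝒦)` iff `Irr(G/N) = {χ ∈ Irr(G) : N ⊆ ker χ}` is a union of parts
of `𝒳`. -/
theorem stmt12 (G : Type) [Group G] [Finite G] (N : Subgroup G) [N.Normal]
    (𝒳 : Set (Set (G → ℂ))) (𝒦 : Set (Set G)) (hSCT : IsSCT G 𝒳 𝒦) :
    CNormal 𝒦 N ↔ ∃ T ⊆ 𝒳, IrrOver N = ⋃₀ T := by
  have : Fintype G := Fintype.ofFinite G
  constructor
  · rintro ⟨T, hT, hNT⟩
    have hconst : ∀ K ∈ 𝒦, ∀ x ∈ K, ∀ y ∈ K, subgroupIndicator N x = subgroupIndicator N y := by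
      intro K hK x hx y hy
      have hmem : ∀ z ∈ K, z ∈ N ↔ K ∈ T := by
        intro z hz
        rw [← SetLike.mem_coe, hNT]
        refine ⟨?_, fun h => ⟨K, h, hz⟩⟩
        rintro ⟨K', hK', hz'⟩
        rwa [(hSCT.2.1.2.2 z (Set.mem_univ z)).unique ⟨hK, hz⟩ ⟨hT hK', hz'⟩]
      simp only [subgroupIndicator, hmem x hx, hmem y hy]
    refine sUnion_parts_eq hSCT.1 (fun _ h => h.1) fun X hX φ hφ ψ hψ hφN => ?_
    have key := charForm_mul_one_eq hSCT.1 (mem_span_sigmaChar hSCT hconst) hX hφ hψ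
    have hφi := hSCT.1.2.1 X hX hφ
    have hψi := hSCT.1.2.1 X hX hψ
    rw [mem_irrOver_iff_sum N hψi]
    rw [charForm_subgroupIndicator, charForm_subgroupIndicator,
      (mem_irrOver_iff_sum N hφi).1 hφN] at key
    have hG : (Nat.card G : ℂ) ≠ 0 := NeZero.ne _
    have h1 := irr_one_ne_zero hφi
    field_simp at key
    exact key.symm
  · rintro ⟨T, hT, hNT⟩
    refine sUnion_parts_eq hSCT.2.1 (Set.subset_univ _) fun K hK x hx y hy hxN => ?_
    have key := sigmaChar_sUnion_eq hSCT hT hK hx hy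
    rw [← hNT, sigmaChar_irrOver] at key
    by_contra hyN
    rw [SetLike.mem_coe] at hxN hyN
    simp [subgroupIndicator, hxN, hyN, N.index_ne_zero_of_finite] at key
end
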